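/- arXiv:1503.04447 — 5 statements merged into one kernel-verified Lean document; each statement's English description precedes it below -/
import Mathlib

section
/- The projective limit Σ∞ is a Choquet simplex in the following sense: the set of extreme points of Σ∞ is a Borel subset of Σ∞, and for every x ∈ Σ∞ there exists a unique Borel probability measure μ on Σ∞ such that μ gives full measure 1 to the set of extreme points of Σ∞ and μ has barycenter x, i.e., for every m : ℕ and every u : V m, ∫ y, (y m) u ∂μ = (x m) u. -/
open scoped BigOperators
open MeasureTheory

/-- The one-step affine projection induced by the cotransition probabilities `lam`:
`(π n x) u = ∑ v, lam n v u * x v`. -/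
def projStep (V : ℕ → Type) [∀ n, Fintype (V n)]
    (lam : ∀ n, V (n + 1) → V n → ℝ) (n : ℕ) (x : V (n + 1) → ℝ) : V n → ℝ :=
  fun u => ∑ v, lam n v u * x v

/-- The projective limit `Σ∞`: sequences `x` with `x n ∈ stdSimplex ℝ (V n)` for all `n`
which are compatible with the projections `π n`. -/
def SigmaInf (V : ℕ → Type) [∀ n, Fintype (V n)]
    (lam : ∀ n, V (n + 1) → V n → ℝ) : Set (∀ n, V n → ℝ) :=
  {x | (∀ n, x n ∈ stdSimplex ℝ (V n)) ∧ ∀ n, projStep V lam n (x (n + 1)) = x n}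

open Filter Topology

namespace SigAux

open Classical in
/-- The truncated path of the vertex `v` at level `n`. -/
noncomputable def phi (V : ℕ → Type) [∀ n, Fintype (V n)]
    (lam : ∀ n, V (n + 1) → V n → ℝ) : ∀ n, V n → ∀ m, V m → ℝ
  | 0, v => Function.update (fun _ _ => 0) 0 (Pi.single v 1)
  | (n+1), v => Function.update (fun m u => ∑ w, lam n v w * phi V lam n w m u) (n+1) (Pi.single v 1)

section
variable {V : ℕ → Type} [∀ n, Fintype (V n)] {lam : ∀ n, V (n + 1) → V n → ℝ}

open Classical in
lemma phi_self (n : ℕ) (v : V n) : phi V lam n v n = Pi.single v 1 := by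
  cases n <;> simp [phi]

lemma phi_succ (n : ℕ) (v : V (n+1)) {m : ℕ} (h : m ≠ n+1) (u : V m) :
    phi V lam (n+1) v m u = ∑ w, lam n v w * phi V lam n w m u := by
  simp [phi, Function.update_of_ne h]

lemma phi_nonneg (hpos : ∀ n (v : V (n + 1)) (u : V n), 0 ≤ lam n v u) (n : ℕ) (v : V n) (m : ℕ)
    (u : V m) : 0 ≤ phi V lam n v m u := by
  classical
  induction n with
  | zero =>
    by_cases h : m = 0
    · subst h
      rw [phi_self]
      exact (Pi.single_nonneg.2 zero_le_one : (0 : V 0 → ℝ) ≤ _) u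
    · simp [phi, Function.update_of_ne h]
  | succ n ih =>
    by_cases h : m = n+1
    · subst h
      rw [phi_self]
      exact (Pi.single_nonneg.2 zero_le_one : (0 : V (n+1) → ℝ) ≤ _) u
    · rw [phi_succ n v h]
      exact Finset.sum_nonneg fun w _ => mul_nonneg (hpos _ _ _) (ih w)

lemma phi_sum (hsum : ∀ n (v : V (n + 1)), ∑ u, lam n v u = 1) (n : ℕ) (v : V n) (m : ℕ)
    (hm : m ≤ n) : ∑ u, phi V lam n v m u = 1 := by
  classical
  induction n with
  | zero =>
    obtain rfl : m = 0 := by omega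
    rw [phi_self]; simp
  | succ n ih =>
    by_cases h : m = n+1
    · subst h
      rw [phi_self]; simp
    · simp_rw [phi_succ n v h]
      rw [Finset.sum_comm]
      simp_rw [← Finset.mul_sum]
      simp [ih _ (by omega : m ≤ n), hsum]

lemma phi_zero (n : ℕ) (v : V n) (m : ℕ) (hm : n < m) (u : V m) : phi V lam n v m u = 0 := by
  induction n with
  | zero => simp [phi, Function.update_of_ne (by omega : m ≠ 0)]
  | succ n ih =>
    rw [phi_succ n v (by omega)]
    simp [ih _ (by omega : n < m)]

lemma phi_le_one (hpos : ∀ n (v : V (n + 1)) (u : V n), 0 ≤ lam n v u)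
    (hsum : ∀ n (v : V (n + 1)), ∑ u, lam n v u = 1) (n : ℕ) (v : V n) (m : ℕ)
    (u : V m) : phi V lam n v m u ≤ 1 := by
  rcases le_or_gt m n with h | h
  · rw [← phi_sum hsum n v m h]
    exact Finset.single_le_sum (f := fun u => phi V lam n v m u)
      (fun i _ => phi_nonneg hpos n v m i) (Finset.mem_univ u)
  · rw [phi_zero n v m h]; exact zero_le_one

lemma phi_proj (n : ℕ) (v : V n) (m : ℕ) (hm : m < n) (u : V m) :
    ∑ w, lam m w u * phi V lam n v (m+1) w = phi V lam n v m u := by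
  classical
  induction n with
  | zero => omega
  | succ n ih =>
    rw [phi_succ n v (by omega)]
    by_cases h : m = n
    · subst h
      rw [phi_self]
      simp_rw [phi_self]
      simp [Pi.single_apply]
    · simp_rw [phi_succ n v (by omega : m + 1 ≠ n + 1), ← ih _ (by omega : m < n), Finset.mul_sum]
      rw [Finset.sum_comm]
      exact Finset.sum_congr rfl fun _ _ => Finset.sum_congr rfl fun _ _ => by ring

lemma step {x : ∀ n, V n → ℝ} (hx : x ∈ SigmaInf V lam) (n : ℕ) (u : V n) :
    ∑ v, lam n v u * x (n+1) v = x n u := congrFun (hx.2 n) u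

lemma sum_phi {x : ∀ n, V n → ℝ} (hx : x ∈ SigmaInf V lam) {m n : ℕ} (h : m ≤ n) (u : V m) :
    ∑ v, x n v * phi V lam n v m u = x m u := by
  classical
  induction n, h using Nat.le_induction with
  | base => simp_rw [phi_self]; simp [Pi.single_apply]
  | succ n h ih =>
    simp_rw [phi_succ n _ (by omega : m ≠ n + 1), Finset.mul_sum]
    rw [Finset.sum_comm, ← ih]
    refine Finset.sum_congr rfl fun w _ => ?_
    rw [← step hx n w, Finset.sum_mul]
    exact Finset.sum_congr rfl fun _ _ => by ring

/-- Second moments. -/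
noncomputable def q (V : ℕ → Type) [∀ n, Fintype (V n)]
    (lam : ∀ n, V (n + 1) → V n → ℝ) (m : ℕ) (u : V m) (k : ℕ) (x : ∀ n, V n → ℝ) : ℝ :=
  ∑ v, x (m+k) v * phi V lam (m+k) v m u ^ 2

lemma sq_sum_le {ι : Type*} [Fintype ι] (w f : ι → ℝ) (hw : ∀ i, 0 ≤ w i) (h1 : ∑ i, w i = 1) :
    (∑ i, w i * f i) ^ 2 ≤ ∑ i, w i * f i ^ 2 := by
  have := (even_two.convexOn_pow (𝕜 := ℝ)).map_sum_le (t := Finset.univ) (w := w) (p := f)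
    (fun i _ => hw i) h1 (fun i _ => Set.mem_univ _)
  simpa using this

lemma q_anti (hpos : ∀ n (v : V (n + 1)) (u : V n), 0 ≤ lam n v u)
    (hsum : ∀ n (v : V (n + 1)), ∑ u, lam n v u = 1)
    (m : ℕ) (u : V m) {x : ∀ n, V n → ℝ} (hx : x ∈ SigmaInf V lam) :
    Antitone fun k => q V lam m u k x := by
  refine antitone_nat_of_succ_le fun k => ?_
  have h1 : q V lam m u k x = ∑ v, x (m+k+1) v * ∑ w, lam (m+k) v w * phi V lam (m+k) w m u ^ 2 := by
    unfold q
    simp_rw [Finset.mul_sum]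
    rw [Finset.sum_comm]
    refine Finset.sum_congr rfl fun w _ => ?_
    rw [← step hx (m+k) w, Finset.sum_mul]
    exact Finset.sum_congr rfl fun _ _ => by ring
  change q V lam m u (k+1) x ≤ q V lam m u k x
  rw [h1]
  change ∑ v : V (m+k+1), x (m+k+1) v * phi V lam (m+k+1) v m u ^ 2 ≤ _
  refine Finset.sum_le_sum fun v _ => mul_le_mul_of_nonneg_left ?_ ((hx.1 _).1 v)
  rw [phi_succ (m+k) v (by omega)]
  exact sq_sum_le _ _ (hpos _ v) (hsum _ v)

lemma sq_le_q (m : ℕ) (u : V m) {x : ∀ n, V n → ℝ} (hx : x ∈ SigmaInf V lam) (k : ℕ) :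
    x m u ^ 2 ≤ q V lam m u k x := by
  rw [← sum_phi hx (Nat.le_add_right m k) u]
  exact sq_sum_le _ _ (hx.1 _).1 (hx.1 _).2

lemma q_le_one (hpos : ∀ n (v : V (n + 1)) (u : V n), 0 ≤ lam n v u)
    (hsum : ∀ n (v : V (n + 1)), ∑ u, lam n v u = 1)
    (m : ℕ) (u : V m) {x : ∀ n, V n → ℝ} (hx : x ∈ SigmaInf V lam) (k : ℕ) :
    q V lam m u k x ≤ 1 := by
  rw [← (hx.1 (m+k)).2]
  refine Finset.sum_le_sum fun v _ => mul_le_of_le_one_right ((hx.1 _).1 v) ?_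
  exact pow_le_one₀ (phi_nonneg hpos _ _ _ _) (phi_le_one hpos hsum _ _ _ _)

/-- Limit second moments. -/
noncomputable def Q (V : ℕ → Type) [∀ n, Fintype (V n)]
    (lam : ∀ n, V (n + 1) → V n → ℝ) (m : ℕ) (u : V m) (x : ∀ n, V n → ℝ) : ℝ :=
  ⨅ k, q V lam m u k x

lemma q_tendsto (hpos : ∀ n (v : V (n + 1)) (u : V n), 0 ≤ lam n v u)
    (hsum : ∀ n (v : V (n + 1)), ∑ u, lam n v u = 1)
    (m : ℕ) (u : V m) {x : ∀ n, V n → ℝ} (hx : x ∈ SigmaInf V lam) :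
    Tendsto (fun k => q V lam m u k x) atTop (𝓝 (Q V lam m u x)) :=
  tendsto_atTop_ciInf (q_anti hpos hsum m u hx)
    ⟨x m u ^ 2, by rintro _ ⟨k, rfl⟩; exact sq_le_q m u hx k⟩

lemma q_tendsto' (hpos : ∀ n (v : V (n + 1)) (u : V n), 0 ≤ lam n v u)
    (hsum : ∀ n (v : V (n + 1)), ∑ u, lam n v u = 1)
    (m : ℕ) (u : V m) {x : ∀ n, V n → ℝ} (hx : x ∈ SigmaInf V lam) :
    Tendsto (fun n => ∑ v, x n v * phi V lam n v m u ^ 2) atTop (𝓝 (Q V lam m u x)) := by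
  rw [← tendsto_add_atTop_iff_nat m]
  convert q_tendsto hpos hsum m u hx using 2 with k
  rw [q, add_comm]

lemma sq_le_Q (hpos : ∀ n (v : V (n + 1)) (u : V n), 0 ≤ lam n v u)
    (hsum : ∀ n (v : V (n + 1)), ∑ u, lam n v u = 1)
    (m : ℕ) (u : V m) {x : ∀ n, V n → ℝ} (hx : x ∈ SigmaInf V lam) :
    x m u ^ 2 ≤ Q V lam m u x :=
  ge_of_tendsto' (q_tendsto hpos hsum m u hx) (sq_le_q m u hx)

lemma coord_nonneg {x : ∀ n, V n → ℝ} (hx : x ∈ SigmaInf V lam) (m : ℕ) (u : V m) : 0 ≤ x m u :=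
  (hx.1 m).1 u

lemma coord_le_one {x : ∀ n, V n → ℝ} (hx : x ∈ SigmaInf V lam) (m : ℕ) (u : V m) : x m u ≤ 1 := by
  rw [← (hx.1 m).2]
  exact Finset.single_le_sum (fun i _ => (hx.1 m).1 i) (Finset.mem_univ u)

/-- One direction of the characterisation of extreme points. -/
lemma extreme_of_Q (hpos : ∀ n (v : V (n + 1)) (u : V n), 0 ≤ lam n v u)
    (hsum : ∀ n (v : V (n + 1)), ∑ u, lam n v u = 1)
    {y : ∀ n, V n → ℝ} (hy : y ∈ SigmaInf V lam)
    (h : ∀ m u, Q V lam m u y = y m u ^ 2) : y ∈ Set.extremePoints ℝ (SigmaInf V lam) := by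
  refine mem_extremePoints.2 ⟨hy, ?_⟩
  rintro a ha b hb ⟨s, t, hs, ht, hst, rfl⟩
  have key : a = b := by
    funext m u
    have hQ : Q V lam m u (s • a + t • b) = s * Q V lam m u a + t * Q V lam m u b := by
      refine tendsto_nhds_unique (q_tendsto hpos hsum m u hy) ?_
      convert ((q_tendsto hpos hsum m u ha).const_mul s).add
        ((q_tendsto hpos hsum m u hb).const_mul t) using 2 with k
      simp only [q, Finset.mul_sum, ← Finset.sum_add_distrib]
      refine Finset.sum_congr rfl fun v _ => ?_
      simp only [Pi.add_apply, Pi.smul_apply, smul_eq_mul]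
      ring
    have h1 := h m u
    rw [hQ] at h1
    simp only [Pi.add_apply, Pi.smul_apply, smul_eq_mul] at h1
    have h2 := mul_le_mul_of_nonneg_left (sq_le_Q hpos hsum m u ha) hs.le
    have h3 := mul_le_mul_of_nonneg_left (sq_le_Q hpos hsum m u hb) ht.le
    have h4 : s * t * (a m u - b m u) ^ 2 ≤ 0 := by
      obtain rfl : t = 1 - s := by linarith
      nlinarith
    have h5 : (a m u - b m u) ^ 2 ≤ 0 := by
      by_contra hc
      push Not at hc
      have := mul_pos (mul_pos hs ht) hc
      linarith
    have := pow_eq_zero_iff (two_ne_zero) |>.1 (le_antisymm h5 (sq_nonneg _))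
    linarith
  subst key
  rw [← add_smul, hst, one_smul]
  exact ⟨rfl, rfl⟩

lemma isClosed_SigmaInf : IsClosed (SigmaInf V lam) := by
  have : SigmaInf V lam = (⋂ n, {x | x n ∈ stdSimplex ℝ (V n)}) ∩
      ⋂ n, {x | projStep V lam n (x (n+1)) = x n} := by
    ext x; simp [SigmaInf]
  rw [this]
  refine (isClosed_iInter fun n => ?_).inter (isClosed_iInter fun n => ?_)
  · exact (isClosed_stdSimplex ℝ (V n)).preimage (continuous_apply n)
  · refine isClosed_eq ?_ (continuous_apply n)
    unfold projStep
    fun_prop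

/-- The limiting measure. -/
lemma exists_lim (hpos : ∀ n (v : V (n + 1)) (u : V n), 0 ≤ lam n v u)
    (hsum : ∀ n (v : V (n + 1)), ∑ u, lam n v u = 1)
    {x : ∀ n, V n → ℝ} (hx : x ∈ SigmaInf V lam) :
    ∃ ν : Measure (SigmaInf V lam), IsProbabilityMeasure ν ∧
      ∀ h : (∀ n, V n → ℝ) → ℝ, Continuous h → ∀ L : ℝ,
        Tendsto (fun n => ∑ v, x n v * h (phi V lam n v)) atTop (𝓝 L) →
        ∫ z, h z ∂ν = L := by
  let X := ∀ n, V n → unitInterval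
  let f : X → ∀ n, V n → ℝ := fun z n v => (z n v : ℝ)
  have hf : Continuous f := by
    refine continuous_pi fun n => continuous_pi fun v => ?_
    exact continuous_subtype_val.comp ((continuous_apply v).comp (continuous_apply n))
  let φ' : ∀ n, V n → X := fun n v m u =>
    ⟨phi V lam n v m u, phi_nonneg hpos _ _ _ _, phi_le_one hpos hsum _ _ _ _⟩
  have hφ : ∀ n v, f (φ' n v) = phi V lam n v := fun n v => rfl
  let μs : ℕ → ProbabilityMeasure X := fun n =>
    ⟨∑ v, ENNReal.ofReal (x n v) • Measure.dirac (φ' n v), ⟨by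
      simp only [Measure.coe_finsetSum, Finset.sum_apply, Measure.smul_apply, measure_univ,
        smul_eq_mul, mul_one]
      rw [← ENNReal.ofReal_sum_of_nonneg fun v _ => (hx.1 n).1 v, (hx.1 n).2, ENNReal.ofReal_one]⟩⟩
  have hμs : ∀ n (h : X → ℝ), Continuous h → ∫ z, h z ∂(μs n : Measure X) = ∑ v, x n v * h (φ' n v) := by
    intro n h hh
    have : ((μs n : ProbabilityMeasure X) : Measure X)
      = ∑ v, ENNReal.ofReal (x n v) • Measure.dirac (φ' n v) := rfl
    rw [this, integral_finsetSum_measure]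
    · refine Finset.sum_congr rfl fun v _ => ?_
      rw [integral_smul_measure, integral_dirac, ENNReal.toReal_ofReal ((hx.1 n).1 v), smul_eq_mul]
    · intro v _
      refine Integrable.smul_measure ?_ ENNReal.ofReal_ne_top
      exact integrable_dirac (by simp)
  let U : Ultrafilter ℕ := Ultrafilter.of atTop
  have hU : (U : Filter ℕ) ≤ atTop := Ultrafilter.of_le _
  obtain ⟨μ, hμ⟩ : ∃ μ, Tendsto μs U (𝓝 μ) := ⟨_, (U.map μs).le_nhds_lim⟩
  have hlim : ∀ h : X → ℝ, Continuous h → ∀ L : ℝ,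
      Tendsto (fun n => ∑ v, x n v * h (φ' n v)) atTop (𝓝 L) → ∫ z, h z ∂(μ : Measure X) = L := by
    intro h hh L hL
    have h1 := (ProbabilityMeasure.tendsto_iff_forall_integral_tendsto.1 hμ)
      (BoundedContinuousFunction.mkOfCompact ⟨h, hh⟩)
    refine tendsto_nhds_unique h1 ((hL.mono_left hU).congr fun n => ?_)
    exact (hμs n h hh).symm
  -- vanishing constraints
  have hzero : ∀ h : (∀ n, V n → ℝ) → ℝ, Continuous h → (∀ z, 0 ≤ h z) →
      (∃ N, ∀ n ≥ N, ∀ v, h (phi V lam n v) = 0) → ∀ᵐ z ∂(μ : Measure X), h (f z) = 0 := by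
    rintro h hh h0 ⟨N, hN⟩
    have hc : Continuous fun z => h (f z) := hh.comp hf
    have h1 : ∫ z, h (f z) ∂(μ : Measure X) = 0 := by
      refine hlim _ hc 0 (tendsto_const_nhds.congr' ?_)
      filter_upwards [eventually_ge_atTop N] with n hn
      simp [hφ, hN n hn]
    have hi : Integrable (fun z => h (f z)) (μ : Measure X) :=
      (BoundedContinuousFunction.mkOfCompact ⟨_, hc⟩).integrable _
    exact (integral_eq_zero_iff_of_nonneg (fun z => h0 _) hi).1 h1
  have hK : ∀ᵐ z ∂(μ : Measure X), f z ∈ SigmaInf V lam := by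
    have h1 : ∀ᵐ z ∂(μ : Measure X), ∀ n, |∑ u, f z n u - 1| = 0 := by
      refine ae_all_iff.2 fun n => hzero (fun y => |∑ u, y n u - 1|) (by fun_prop)
        (fun _ => abs_nonneg _) ⟨n, fun k hk v => ?_⟩
      simp [phi_sum hsum k v n hk]
    have h2 : ∀ᵐ z ∂(μ : Measure X), ∀ n u, |∑ v, lam n v u * f z (n+1) v - f z n u| = 0 := by
      refine ae_all_iff.2 fun n => ae_all_iff.2 fun u =>
        hzero (fun y => |∑ v, lam n v u * y (n+1) v - y n u|) (by fun_prop)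
        (fun _ => abs_nonneg _) ⟨n+1, fun k hk v => ?_⟩
      simp [phi_proj k v n hk]
    filter_upwards [h1, h2] with z hz1 hz2
    refine ⟨fun n => ⟨fun u => (z n u).2.1, ?_⟩, fun n => funext fun u => ?_⟩
    · have := abs_eq_zero.1 (hz1 n); linarith
    · have := abs_eq_zero.1 (hz2 n u)
      show ∑ v, lam n v u * f z (n+1) v = f z n u
      linarith
  have hKm : MeasurableSet (SigmaInf V lam) := isClosed_SigmaInf.measurableSet
  have hK' : ∀ᵐ y ∂((μ : Measure X).map f), y ∈ SigmaInf V lam :=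
    (ae_map_iff hf.aemeasurable hKm).2 hK
  have hmap : (((μ : Measure X).map f).comap (Subtype.val : SigmaInf V lam → _)).map Subtype.val
      = (μ : Measure X).map f := by
    rw [(MeasurableEmbedding.subtype_coe hKm).map_comap, Subtype.range_coe,
      Measure.restrict_eq_self_of_ae_mem hK']
  have hpm : IsProbabilityMeasure ((μ : Measure X).map f) :=
    Measure.isProbabilityMeasure_map hf.aemeasurable
  refine ⟨((μ : Measure X).map f).comap Subtype.val, ⟨?_⟩, fun h hh L hL => ?_⟩
  · have : (((μ : Measure X).map f).comap (Subtype.val : SigmaInf V lam → _)).map Subtype.val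
        Set.univ = 1 := by rw [hmap]; exact measure_univ
    rwa [Measure.map_apply measurable_subtype_coe MeasurableSet.univ, Set.preimage_univ] at this
  · rw [← (MeasurableEmbedding.subtype_coe hKm).integral_map (g := h), hmap,
      integral_map hf.aemeasurable hh.aestronglyMeasurable]
    exact hlim _ (hh.comp hf) L hL

lemma measurable_coord (m : ℕ) (u : V m) :
    Measurable fun z : SigmaInf V lam => (z : ∀ n, V n → ℝ) m u :=
  (measurable_pi_apply u).comp ((measurable_pi_apply m).comp measurable_subtype_coe)

lemma integrable_of_bdd {ν : Measure (SigmaInf V lam)} [IsProbabilityMeasure ν]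
    {g : SigmaInf V lam → ℝ} (hg : Measurable g) (C : ℝ) (hC : ∀ z, |g z| ≤ C) :
    Integrable g ν :=
  Integrable.of_bound hg.aestronglyMeasurable C (ae_of_all _ hC)

lemma integrable_coord {ν : Measure (SigmaInf V lam)} [IsProbabilityMeasure ν] (m : ℕ) (u : V m) :
    Integrable (fun z : SigmaInf V lam => (z : ∀ n, V n → ℝ) m u) ν :=
  integrable_of_bdd (measurable_coord m u) 1 fun z => by
    rw [abs_of_nonneg (coord_nonneg z.2 m u)]; exact coord_le_one z.2 m u

lemma weighted_mem {ν : Measure (SigmaInf V lam)} [IsProbabilityMeasure ν]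
    {w : SigmaInf V lam → ℝ} (hw : Measurable w) (C : ℝ) (hC : ∀ z, |w z| ≤ C)
    (h0 : ∀ z, 0 ≤ w z) (h1 : ∫ z, w z ∂ν = 1) :
    (fun m u => ∫ z, w z * (z : ∀ n, V n → ℝ) m u ∂ν) ∈ SigmaInf V lam := by
  have hi : ∀ m u, Integrable (fun z : SigmaInf V lam => w z * (z : ∀ n, V n → ℝ) m u) ν := by
    intro m u
    refine integrable_of_bdd (hw.mul (measurable_coord m u)) C fun z => ?_
    rw [abs_mul, abs_of_nonneg (coord_nonneg z.2 m u)]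
    exact (mul_le_of_le_one_right (abs_nonneg _) (coord_le_one z.2 m u)).trans (hC z)
  refine ⟨fun n => ⟨fun u => integral_nonneg fun z => mul_nonneg (h0 z) (coord_nonneg z.2 n u), ?_⟩,
    fun n => funext fun u => ?_⟩
  · rw [← integral_finsetSum _ fun u _ => hi n u, ← h1]
    refine integral_congr_ae (ae_of_all _ fun z => ?_)
    simp only
    rw [← Finset.mul_sum, (z.2.1 n).2, mul_one]
  · simp only [projStep]
    simp_rw [← integral_const_mul]
    rw [← integral_finsetSum _ fun v _ => (hi (n+1) v).const_mul _]
    refine integral_congr_ae (ae_of_all _ fun z => ?_)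
    simp only
    rw [← step z.2 n u, Finset.mul_sum]
    exact Finset.sum_congr rfl fun _ _ => by ring

lemma exists_rep (hpos : ∀ n (v : V (n + 1)) (u : V n), 0 ≤ lam n v u)
    (hsum : ∀ n (v : V (n + 1)), ∑ u, lam n v u = 1)
    {x : ∀ n, V n → ℝ} (hx : x ∈ SigmaInf V lam) :
    ∃ ν : Measure (SigmaInf V lam), IsProbabilityMeasure ν ∧
      (∀ m u, ∫ z, (z : ∀ n, V n → ℝ) m u ∂ν = x m u) ∧
      (∀ m u, ∫ z, (z : ∀ n, V n → ℝ) m u ^ 2 ∂ν = Q V lam m u x) := by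
  obtain ⟨ν, hν, h⟩ := exists_lim hpos hsum hx
  refine ⟨ν, hν, fun m u => ?_, fun m u => ?_⟩
  · refine h (fun z => z m u) (by fun_prop) _ (tendsto_const_nhds.congr' ?_)
    filter_upwards [eventually_ge_atTop m] with n hn
    exact (sum_phi hx hn u).symm
  · exact h (fun z => z m u ^ 2) (by fun_prop) _ (q_tendsto' hpos hsum m u hx)

lemma Q_of_extreme (hpos : ∀ n (v : V (n + 1)) (u : V n), 0 ≤ lam n v u)
    (hsum : ∀ n (v : V (n + 1)), ∑ u, lam n v u = 1)
    {y : ∀ n, V n → ℝ} (hy : y ∈ Set.extremePoints ℝ (SigmaInf V lam)) (m : ℕ) (u : V m) :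
    Q V lam m u y = y m u ^ 2 := by
  have hyK := hy.1
  obtain ⟨ν, hν, hbar, hQ⟩ := exists_rep hpos hsum hyK
  have b0 := coord_nonneg hyK m u
  have b1 := coord_le_one hyK m u
  have hic : ∀ c : ℝ, ∫ z : SigmaInf V lam, (1 + c * ((z : ∀ n, V n → ℝ) m u - y m u)) ∂ν = 1 := by
    intro c
    have hi : Integrable (fun z : SigmaInf V lam => (z : ∀ n, V n → ℝ) m u - y m u) ν :=
      (integrable_coord m u).sub (integrable_const _)
    rw [integral_add (integrable_const _) (hi.const_mul c),
      integral_const_mul, integral_sub (integrable_coord m u) (integrable_const _), hbar]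
    simp
  have hmeas : ∀ c : ℝ, Measurable fun z : SigmaInf V lam => 1 + c * ((z : ∀ n, V n → ℝ) m u - y m u) :=
    fun c => (((measurable_coord m u).sub_const _).const_mul c).const_add 1
  have hprod : ∀ k w, Integrable (fun z : SigmaInf V lam =>
      ((z : ∀ n, V n → ℝ) m u - y m u) * (z : ∀ n, V n → ℝ) k w) ν := by
    intro k w
    refine integrable_of_bdd (((measurable_coord m u).sub_const _).mul (measurable_coord k w)) 1 fun z => ?_
    rw [abs_mul]
    have a0 := coord_nonneg z.2 m u
    have a1 := coord_le_one z.2 m u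
    have c0 := coord_nonneg z.2 k w
    have c1 := coord_le_one z.2 k w
    refine mul_le_one₀ (abs_le.2 ⟨by linarith, by linarith⟩) (abs_nonneg _) (abs_le.2 ⟨by linarith, by linarith⟩)
  have hform : ∀ (c : ℝ) k w, ∫ z : SigmaInf V lam, (1 + c * ((z : ∀ n, V n → ℝ) m u - y m u))
      * (z : ∀ n, V n → ℝ) k w ∂ν = y k w + c * ∫ z : SigmaInf V lam,
        ((z : ∀ n, V n → ℝ) m u - y m u) * (z : ∀ n, V n → ℝ) k w ∂ν := by
    intro c k w
    rw [← hbar k w, ← integral_const_mul, ← integral_add (integrable_coord k w) ((hprod k w).const_mul c)]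
    exact integral_congr_ae (ae_of_all _ fun z => by simp only; ring)
  have hmem : ∀ c : ℝ, |c| ≤ 1 → (fun k w => ∫ z : SigmaInf V lam,
      (1 + c * ((z : ∀ n, V n → ℝ) m u - y m u)) * (z : ∀ n, V n → ℝ) k w ∂ν) ∈ SigmaInf V lam := by
    intro c hc
    have hb : ∀ z : SigmaInf V lam, |c * ((z : ∀ n, V n → ℝ) m u - y m u)| ≤ 1 := by
      intro z
      have a0 := coord_nonneg z.2 m u
      have a1 := coord_le_one z.2 m u
      rw [abs_mul]
      exact mul_le_one₀ hc (abs_nonneg _) (abs_le.2 ⟨by linarith, by linarith⟩)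
    refine weighted_mem (hmeas c) 2 (fun z => ?_) (fun z => ?_) (hic c)
    · have := abs_le.1 (hb z)
      exact abs_le.2 ⟨by linarith, by linarith⟩
    · have := abs_le.1 (hb z)
      linarith
  have ha := hmem 1 (by simp)
  have hb := hmem (-1) (by simp)
  have hext := (mem_extremePoints.1 hy).2 _ ha _ hb
    ⟨1/2, 1/2, by norm_num, by norm_num, by norm_num, by
      funext k w
      simp only [Pi.add_apply, Pi.smul_apply, smul_eq_mul]
      rw [hform, hform]; ring⟩
  have h1 := congrFun (congrFun hext.1 m) u
  rw [hform] at h1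
  have h2 : ∫ z : SigmaInf V lam, ((z : ∀ n, V n → ℝ) m u - y m u) * (z : ∀ n, V n → ℝ) m u ∂ν = 0 := by
    linarith
  have h3 : ∫ z : SigmaInf V lam, (z : ∀ n, V n → ℝ) m u ^ 2 ∂ν = y m u * y m u + 
      ∫ z : SigmaInf V lam, ((z : ∀ n, V n → ℝ) m u - y m u) * (z : ∀ n, V n → ℝ) m u ∂ν := by
    nth_rewrite 2 [← hbar m u]
    rw [← integral_const_mul, ← integral_add ((integrable_coord m u).const_mul _) (hprod m u)]
    exact integral_congr_ae (ae_of_all _ fun z => by simp only; ring)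
  rw [← hQ, h3, h2]; ring

lemma extreme_iff (hpos : ∀ n (v : V (n + 1)) (u : V n), 0 ≤ lam n v u)
    (hsum : ∀ n (v : V (n + 1)), ∑ u, lam n v u = 1)
    {y : ∀ n, V n → ℝ} (hy : y ∈ SigmaInf V lam) :
    y ∈ Set.extremePoints ℝ (SigmaInf V lam) ↔ ∀ m u, Q V lam m u y = y m u ^ 2 :=
  ⟨fun h m u => Q_of_extreme hpos hsum h m u, extreme_of_Q hpos hsum hy⟩

lemma measurable_q (m : ℕ) (u : V m) (k : ℕ) :
    Measurable fun z : SigmaInf V lam => q V lam m u k z := by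
  unfold q
  exact Finset.measurable_sum _ fun v _ => (measurable_coord _ v).mul_const _

lemma measurable_Q (m : ℕ) (u : V m) :
    Measurable fun z : SigmaInf V lam => Q V lam m u z :=
  Measurable.iInf fun k => measurable_q m u k

lemma measurableSet_extreme (hpos : ∀ n (v : V (n + 1)) (u : V n), 0 ≤ lam n v u)
    (hsum : ∀ n (v : V (n + 1)), ∑ u, lam n v u = 1) :
    MeasurableSet {y : SigmaInf V lam |
        (y : ∀ n, V n → ℝ) ∈ Set.extremePoints ℝ (SigmaInf V lam)} := by
  have : {y : SigmaInf V lam | (y : ∀ n, V n → ℝ) ∈ Set.extremePoints ℝ (SigmaInf V lam)} =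
      ⋂ m, ⋂ u : V m, {y : SigmaInf V lam | Q V lam m u y = (y : ∀ n, V n → ℝ) m u ^ 2} := by
    ext y
    simp [extreme_iff hpos hsum y.2]
  rw [this]
  exact MeasurableSet.iInter fun m => MeasurableSet.iInter fun u =>
    measurableSet_eq_fun (measurable_Q m u) ((measurable_coord m u).pow_const 2)

lemma integral_affine {ν : Measure (SigmaInf V lam)} [IsProbabilityMeasure ν]
    {x : ∀ n, V n → ℝ} (hbar : ∀ m u, ∫ z, (z : ∀ n, V n → ℝ) m u ∂ν = x m u)
    (n : ℕ) (c : V n → ℝ) :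
    ∫ z : SigmaInf V lam, ∑ v, (z : ∀ n, V n → ℝ) n v * c v ∂ν = ∑ v, x n v * c v := by
  rw [integral_finsetSum _ fun v _ => (integrable_coord n v).mul_const _]
  simp_rw [integral_mul_const, hbar]

lemma affine_bound {y : ∀ n, V n → ℝ} (hy : y ∈ SigmaInf V lam) (n : ℕ) (c : V n → ℝ) (C : ℝ)
    (hC : ∀ v, |c v| ≤ C) : |∑ v, y n v * c v| ≤ C := by
  calc |∑ v, y n v * c v| ≤ ∑ v, |y n v * c v| := Finset.abs_sum_le_sum_abs _ _
    _ ≤ ∑ v, y n v * C := Finset.sum_le_sum fun v _ => by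
        rw [abs_mul, abs_of_nonneg (coord_nonneg hy n v)]
        exact mul_le_mul_of_nonneg_left (hC v) (coord_nonneg hy n v)
    _ = C := by rw [← Finset.sum_mul, (hy.1 n).2, one_mul]

lemma Q_nonneg (hpos : ∀ n (v : V (n + 1)) (u : V n), 0 ≤ lam n v u)
    (hsum : ∀ n (v : V (n + 1)), ∑ u, lam n v u = 1)
    (m : ℕ) (u : V m) {x : ∀ n, V n → ℝ} (hx : x ∈ SigmaInf V lam) : 0 ≤ Q V lam m u x :=
  (sq_nonneg _).trans (sq_le_Q hpos hsum m u hx)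

lemma integral_Q (hpos : ∀ n (v : V (n + 1)) (u : V n), 0 ≤ lam n v u)
    (hsum : ∀ n (v : V (n + 1)), ∑ u, lam n v u = 1)
    {ν : Measure (SigmaInf V lam)} [IsProbabilityMeasure ν]
    {x : ∀ n, V n → ℝ} (hx : x ∈ SigmaInf V lam)
    (hbar : ∀ m u, ∫ z, (z : ∀ n, V n → ℝ) m u ∂ν = x m u) (m : ℕ) (u : V m) :
    ∫ z : SigmaInf V lam, Q V lam m u z ∂ν = Q V lam m u x := by
  have h1 : Tendsto (fun k => ∫ z : SigmaInf V lam, q V lam m u k z ∂ν) atTop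
      (𝓝 (∫ z : SigmaInf V lam, Q V lam m u z ∂ν)) := by
    refine tendsto_integral_of_dominated_convergence (fun _ => 1)
      (fun k => (measurable_q m u k).aestronglyMeasurable) (integrable_const _)
      (fun k => ae_of_all _ fun z => ?_) (ae_of_all _ fun z => q_tendsto hpos hsum m u z.2)
    rw [Real.norm_eq_abs, abs_of_nonneg ((sq_nonneg _).trans (sq_le_q m u z.2 k))]
    exact q_le_one hpos hsum m u z.2 k
  refine tendsto_nhds_unique h1 ((q_tendsto hpos hsum m u hx).congr fun k => ?_)
  exact (integral_affine hbar (m+k) _).symm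

lemma exists_good (hpos : ∀ n (v : V (n + 1)) (u : V n), 0 ≤ lam n v u)
    (hsum : ∀ n (v : V (n + 1)), ∑ u, lam n v u = 1)
    {x : ∀ n, V n → ℝ} (hx : x ∈ SigmaInf V lam) :
    ∃ ν : Measure (SigmaInf V lam), IsProbabilityMeasure ν ∧
      ν {y : SigmaInf V lam |
            (y : ∀ n, V n → ℝ) ∈ Set.extremePoints ℝ (SigmaInf V lam)} = 1 ∧
      ∀ m u, ∫ z, (z : ∀ n, V n → ℝ) m u ∂ν = x m u := by
  obtain ⟨ν, hν, hbar, hQ⟩ := exists_rep hpos hsum hx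
  refine ⟨ν, hν, ?_, hbar⟩
  rw [← mem_ae_iff_prob_eq_one (measurableSet_extreme hpos hsum)]
  have h : ∀ᵐ z : SigmaInf V lam ∂ν, ∀ m u, Q V lam m u z - (z : ∀ n, V n → ℝ) m u ^ 2 = 0 := by
    refine ae_all_iff.2 fun m => ae_all_iff.2 fun u => ?_
    have i1 : Integrable (fun z : SigmaInf V lam => Q V lam m u z) ν := by
      refine integrable_of_bdd (measurable_Q m u) 1 fun z => ?_
      rw [abs_of_nonneg (Q_nonneg hpos hsum m u z.2)]
      exact le_of_tendsto' (q_tendsto hpos hsum m u z.2) (q_le_one hpos hsum m u z.2)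
    have i2 : Integrable (fun z : SigmaInf V lam => (z : ∀ n, V n → ℝ) m u ^ 2) ν := by
      refine integrable_of_bdd ((measurable_coord m u).pow_const 2) 1 fun z => ?_
      rw [abs_of_nonneg (sq_nonneg _)]
      exact pow_le_one₀ (coord_nonneg z.2 m u) (coord_le_one z.2 m u)
    refine (integral_eq_zero_iff_of_nonneg
      (f := fun z : SigmaInf V lam => Q V lam m u z - (z : ∀ n, V n → ℝ) m u ^ 2)
      (fun z => sub_nonneg.2 (sq_le_Q hpos hsum m u z.2)) (i1.sub i2)).1 ?_
    rw [integral_sub i1 i2, integral_Q hpos hsum hx hbar, hQ, sub_self]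
  filter_upwards [h] with z hz
  exact (extreme_iff hpos hsum z.2).2 fun m u => sub_eq_zero.1 (hz m u)

lemma var_tendsto (hpos : ∀ n (v : V (n + 1)) (u : V n), 0 ≤ lam n v u)
    (hsum : ∀ n (v : V (n + 1)), ∑ u, lam n v u = 1)
    {y : ∀ n, V n → ℝ} (hy : y ∈ SigmaInf V lam) (m : ℕ) (u : V m)
    (h : Q V lam m u y = y m u ^ 2) :
    Tendsto (fun n => ∑ v, y n v * (phi V lam n v m u - y m u) ^ 2) atTop (𝓝 0) := by
  have h1 := (q_tendsto' hpos hsum m u hy).sub_const (y m u ^ 2)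
  rw [h, sub_self] at h1
  refine h1.congr' ?_
  filter_upwards [eventually_ge_atTop m] with n hn
  have e : ∑ v, y n v * (phi V lam n v m u - y m u) ^ 2
      = ∑ v, y n v * phi V lam n v m u ^ 2 - 2 * y m u * (∑ v, y n v * phi V lam n v m u)
        + y m u ^ 2 * ∑ v, y n v := by
    rw [Finset.mul_sum, Finset.mul_sum, ← Finset.sum_sub_distrib, ← Finset.sum_add_distrib]
    exact Finset.sum_congr rfl fun v _ => by ring
  rw [e, sum_phi hy hn, (hy.1 n).2]
  ring

lemma local_bound (y : ∀ n, V n → ℝ) (F : (∀ n, V n → ℝ) → ℝ) (hF : Continuous F) {ε : ℝ}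
    (hε : 0 < ε) : ∃ N : ℕ, ∀ z : ∀ n, V n → ℝ,
      ∑ m ∈ Finset.range N, ∑ u, (z m u - y m u) ^ 2 < 1 / ((N : ℝ) + 1) → |F z - F y| < ε := by
  by_contra! hc
  choose z hz1 hz2 using hc
  have hz : Tendsto z atTop (𝓝 y) := by
    refine tendsto_pi_nhds.2 fun m => tendsto_pi_nhds.2 fun u => ?_
    have h0 : Tendsto (fun N => (z N m u - y m u) ^ 2) atTop (𝓝 0) := by
      refine squeeze_zero' (Eventually.of_forall fun _ => sq_nonneg _) ?_
        tendsto_one_div_add_atTop_nhds_zero_nat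
      filter_upwards [eventually_gt_atTop m] with N hN
      refine le_trans ?_ (hz1 N).le
      calc (z N m u - y m u) ^ 2 ≤ ∑ u, (z N m u - y m u) ^ 2 :=
            Finset.single_le_sum (f := fun u => (z N m u - y m u) ^ 2)
              (fun _ _ => sq_nonneg _) (Finset.mem_univ u)
        _ ≤ _ := Finset.single_le_sum (f := fun m => ∑ u, (z N m u - y m u) ^ 2)
              (fun _ _ => Finset.sum_nonneg fun _ _ => sq_nonneg _) (Finset.mem_range.2 hN)
    have h1 := (Real.continuous_sqrt.tendsto 0).comp h0
    simp only [Real.sqrt_zero] at h1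
    have h2 : Tendsto (fun N => z N m u - y m u) atTop (𝓝 0) := by
      rw [tendsto_zero_iff_abs_tendsto_zero]
      refine h1.congr fun N => ?_
      simp [Real.sqrt_sq_eq_abs]
    simpa using h2.add_const (y m u)
  have h3 := ((hF.tendsto y).comp hz).sub_const (F y)
  rw [sub_self] at h3
  have h4 := h3.abs
  rw [abs_zero] at h4
  obtain ⟨N, hN⟩ := (h4.eventually (gt_mem_nhds hε)).exists
  exact absurd hN (not_lt.2 (hz2 N))

lemma conv_extreme (hpos : ∀ n (v : V (n + 1)) (u : V n), 0 ≤ lam n v u)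
    (hsum : ∀ n (v : V (n + 1)), ∑ u, lam n v u = 1)
    {y : ∀ n, V n → ℝ} (hy : y ∈ SigmaInf V lam)
    (h : ∀ m u, Q V lam m u y = y m u ^ 2)
    (F : (∀ n, V n → ℝ) → ℝ) (hF : Continuous F) (C : ℝ) (hC : ∀ z, |F z| ≤ C) :
    Tendsto (fun n => ∑ v, y n v * F (phi V lam n v)) atTop (𝓝 (F y)) := by
  have hC0 : 0 ≤ C := (abs_nonneg _).trans (hC y)
  rw [Metric.tendsto_atTop']
  intro ε hε
  obtain ⟨N, hN⟩ := local_bound y F hF (half_pos hε)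
  set D : (∀ n, V n → ℝ) → ℝ := fun z => ∑ m ∈ Finset.range N, ∑ u, (z m u - y m u) ^ 2 with hD
  have hD0 : ∀ z, 0 ≤ D z := fun z =>
    Finset.sum_nonneg fun _ _ => Finset.sum_nonneg fun _ _ => sq_nonneg _
  have hN0 : (0 : ℝ) < (N : ℝ) + 1 := by positivity
  have hb : ∀ z, |F z - F y| ≤ ε / 2 + 2 * C * (N + 1) * D z := by
    intro z
    rcases lt_or_ge (D z) (1 / ((N : ℝ) + 1)) with hz | hz
    · have := hN z hz
      have : 0 ≤ 2 * C * (N + 1) * D z := by have := hD0 z; positivity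
      linarith
    · have h1 : |F z - F y| ≤ 2 * C := by
        have := abs_sub (F z) (F y)
        have := hC z
        have := hC y
        linarith
      have h2 : 1 ≤ ((N : ℝ) + 1) * D z := by
        rw [div_le_iff₀ hN0] at hz
        linarith
      have h3 : 2 * C * 1 ≤ 2 * C * (((N : ℝ) + 1) * D z) :=
        mul_le_mul_of_nonneg_left h2 (by positivity)
      linarith
  have ht : Tendsto (fun n => ∑ v, y n v * D (phi V lam n v)) atTop (𝓝 0) := by
    have h1 : Tendsto (fun n => ∑ m ∈ Finset.range N, ∑ u : V m,
        ∑ v, y n v * (phi V lam n v m u - y m u) ^ 2) atTop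
        (𝓝 (∑ m ∈ Finset.range N, ∑ _u : V m, (0 : ℝ))) :=
      tendsto_finsetSum _ fun m _ => tendsto_finsetSum _ fun u _ =>
        var_tendsto hpos hsum hy m u (h m u)
    simp only [Finset.sum_const_zero] at h1
    refine h1.congr fun n => ?_
    simp only [hD, Finset.mul_sum]
    rw [Finset.sum_comm]
    refine Finset.sum_congr rfl fun m _ => ?_
    rw [Finset.sum_comm]
  have ht2 := ht.const_mul (2 * C * (N + 1))
  rw [mul_zero] at ht2
  obtain ⟨n0, hn0⟩ := eventually_atTop.1 (ht2.eventually (gt_mem_nhds (half_pos hε)))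
  refine ⟨n0, fun n hn => ?_⟩
  rw [Real.dist_eq]
  have e : ∑ v, y n v * F (phi V lam n v) - F y = ∑ v, y n v * (F (phi V lam n v) - F y) := by
    simp_rw [mul_sub, Finset.sum_sub_distrib, ← Finset.sum_mul, (hy.1 n).2, one_mul]
  rw [e]
  calc |∑ v, y n v * (F (phi V lam n v) - F y)|
      ≤ ∑ v, |y n v * (F (phi V lam n v) - F y)| := Finset.abs_sum_le_sum_abs _ _
    _ ≤ ∑ v, y n v * (ε / 2 + 2 * C * (N + 1) * D (phi V lam n v)) :=
        Finset.sum_le_sum fun v _ => by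
          rw [abs_mul, abs_of_nonneg (coord_nonneg hy n v)]
          exact mul_le_mul_of_nonneg_left (hb _) (coord_nonneg hy n v)
    _ = (∑ v, y n v) * (ε / 2) + 2 * C * (N + 1) * ∑ v, y n v * D (phi V lam n v) := by
        rw [Finset.mul_sum, Finset.sum_mul, ← Finset.sum_add_distrib]
        exact Finset.sum_congr rfl fun v _ => by ring
    _ < ε := by
        rw [(hy.1 n).2]
        have := hn0 n hn.le
        linarith

lemma lim_of_good (hpos : ∀ n (v : V (n + 1)) (u : V n), 0 ≤ lam n v u)
    (hsum : ∀ n (v : V (n + 1)), ∑ u, lam n v u = 1)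
    {ν : Measure (SigmaInf V lam)} [IsProbabilityMeasure ν]
    {x : ∀ n, V n → ℝ}
    (hE : ν {y : SigmaInf V lam |
            (y : ∀ n, V n → ℝ) ∈ Set.extremePoints ℝ (SigmaInf V lam)} = 1)
    (hbar : ∀ m u, ∫ z, (z : ∀ n, V n → ℝ) m u ∂ν = x m u)
    (F : BoundedContinuousFunction (∀ n, V n → ℝ) ℝ) :
    Tendsto (fun n => ∑ v, x n v * F (phi V lam n v)) atTop
      (𝓝 (∫ z : SigmaInf V lam, F z ∂ν)) := by
  rw [← mem_ae_iff_prob_eq_one (measurableSet_extreme hpos hsum)] at hE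
  have h1 : Tendsto (fun n => ∫ z : SigmaInf V lam,
      ∑ v, (z : ∀ n, V n → ℝ) n v * F (phi V lam n v) ∂ν) atTop
      (𝓝 (∫ z : SigmaInf V lam, F z ∂ν)) := by
    refine tendsto_integral_of_dominated_convergence (fun _ => ‖F‖)
      (fun n => (Finset.measurable_sum _ fun v _ =>
        (measurable_coord n v).mul_const _).aestronglyMeasurable) (integrable_const _)
      (fun n => ae_of_all _ fun z => affine_bound z.2 n _ _ fun v => F.norm_coe_le_norm _) ?_
    filter_upwards [hE] with z hz
    exact conv_extreme hpos hsum z.2 ((extreme_iff hpos hsum z.2).1 hz) F F.continuous ‖F‖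
      F.norm_coe_le_norm
  exact h1.congr fun n => integral_affine hbar n _

lemma unique_good (hpos : ∀ n (v : V (n + 1)) (u : V n), 0 ≤ lam n v u)
    (hsum : ∀ n (v : V (n + 1)), ∑ u, lam n v u = 1)
    {ν ν' : Measure (SigmaInf V lam)} [IsProbabilityMeasure ν] [IsProbabilityMeasure ν']
    {x : ∀ n, V n → ℝ}
    (hE : ν {y : SigmaInf V lam |
            (y : ∀ n, V n → ℝ) ∈ Set.extremePoints ℝ (SigmaInf V lam)} = 1)
    (hbar : ∀ m u, ∫ z, (z : ∀ n, V n → ℝ) m u ∂ν = x m u)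
    (hE' : ν' {y : SigmaInf V lam |
            (y : ∀ n, V n → ℝ) ∈ Set.extremePoints ℝ (SigmaInf V lam)} = 1)
    (hbar' : ∀ m u, ∫ z, (z : ∀ n, V n → ℝ) m u ∂ν' = x m u) : ν = ν' := by
  have hemb := MeasurableEmbedding.subtype_coe (isClosed_SigmaInf (V := V) (lam := lam)).measurableSet
  have hp : IsProbabilityMeasure (ν.map Subtype.val) :=
    Measure.isProbabilityMeasure_map measurable_subtype_coe.aemeasurable
  have hp' : IsProbabilityMeasure (ν'.map Subtype.val) :=
    Measure.isProbabilityMeasure_map measurable_subtype_coe.aemeasurable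
  have : ν.map Subtype.val = ν'.map Subtype.val := by
    refine ext_of_forall_integral_eq_of_IsFiniteMeasure fun F => ?_
    rw [hemb.integral_map, hemb.integral_map]
    exact tendsto_nhds_unique (lim_of_good hpos hsum hE hbar F) (lim_of_good hpos hsum hE' hbar' F)
  rw [← hemb.comap_map ν, this, hemb.comap_map]

end
end SigAux

/-- `Σ∞` is a Choquet simplex: its set of extreme points is Borel, and every
point `x ∈ Σ∞` is the barycenter of a unique Borel probability measure concentrated on the
set of extreme points. -/
theorem sigmaInf_choquet_simplex
    (V : ℕ → Type) [∀ n, Fintype (V n)] [∀ n, Nonempty (V n)]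
    (lam : ∀ n, V (n + 1) → V n → ℝ)
    (hpos : ∀ n (v : V (n + 1)) (u : V n), 0 ≤ lam n v u)
    (hsum : ∀ n (v : V (n + 1)), ∑ u, lam n v u = 1) :
    MeasurableSet {y : SigmaInf V lam |
        (y : ∀ n, V n → ℝ) ∈ Set.extremePoints ℝ (SigmaInf V lam)} ∧
    ∀ x ∈ SigmaInf V lam,
      ∃! μ : Measure (SigmaInf V lam),
        IsProbabilityMeasure μ ∧
        μ {y : SigmaInf V lam |
            (y : ∀ n, V n → ℝ) ∈ Set.extremePoints ℝ (SigmaInf V lam)} = 1 ∧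
        ∀ (m : ℕ) (u : V m), (∫ y, ((y : ∀ n, V n → ℝ) m u) ∂μ) = x m u := by
  refine ⟨SigAux.measurableSet_extreme hpos hsum, fun x hx => ?_⟩
  obtain ⟨ν, hν, hE, hbar⟩ := SigAux.exists_good hpos hsum hx
  refine ⟨ν, ⟨hν, hE, hbar⟩, ?_⟩
  rintro ν' ⟨hν', hE', hbar'⟩
  exact SigAux.unique_good hpos hsum hE' hbar' hE hbar
end

section
/- A point x of the projective limit Σ∞ is an extreme point of Σ∞ if and only if for every m the decomposition measures ν_n^m converge weakly, as n → ∞, to the Dirac measure at x m; concretely: x ∈ extremePoints ℝ Σ∞ if and only if for every m : ℕ and every continuous function f : (V m → ℝ) → ℝ, the sums ∑_{v : V n} (x n) v * f (π[n,m] (e v)) converge, as n → ∞, to f (x m). -/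
open scoped BigOperators
open Filter Topology

/-- The iterated projection `π[n,m] = π m ∘ ⋯ ∘ π (n-1)` for `m ≤ n` (with `π[n,n] = id`). -/
def projIter (V : ℕ → Type) [∀ n, Fintype (V n)]
    (lam : ∀ n, V (n + 1) → V n → ℝ) {m n : ℕ} (h : m ≤ n) :
    (V n → ℝ) → V m → ℝ :=
  Nat.leRecOn (C := fun k => (V k → ℝ) → V m → ℝ) h
    (fun {k} f x => f (projStep V lam k x)) id

/-- The vertex `e v` of the simplex `stdSimplex ℝ (V n)`: the indicator function of `v`. -/
def vert (V : ℕ → Type) [∀ n, DecidableEq (V n)] {n : ℕ} (v : V n) : V n → ℝ :=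
  fun u => if u = v then 1 else 0

theorem projIter_self' (V : ℕ → Type) [∀ n, Fintype (V n)]
    (lam : ∀ n, V (n + 1) → V n → ℝ) {m : ℕ} (h : m ≤ m) (y : V m → ℝ) :
    projIter V lam h y = y := by
  unfold projIter
  rw [Nat.leRecOn_self]; rfl

theorem projIter_succ' (V : ℕ → Type) [∀ n, Fintype (V n)]
    (lam : ∀ n, V (n + 1) → V n → ℝ) {m n : ℕ} (h : m ≤ n) (h' : m ≤ n + 1) (y : V (n + 1) → ℝ) :
    projIter V lam h' y = projIter V lam h (projStep V lam n y) := by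
  unfold projIter
  rw [Nat.leRecOn_succ h]

theorem projStep_sum (V : ℕ → Type) [∀ n, Fintype (V n)]
    (lam : ∀ n, V (n + 1) → V n → ℝ)
    (hsum : ∀ n (v : V (n + 1)), ∑ u, lam n v u = 1) (n : ℕ) (y : V (n + 1) → ℝ) :
    ∑ u, projStep V lam n y u = ∑ v, y v := by
  unfold projStep
  rw [Finset.sum_comm]
  simp [← Finset.sum_mul, hsum]

theorem projIter_sum (V : ℕ → Type) [∀ n, Fintype (V n)]
    (lam : ∀ n, V (n + 1) → V n → ℝ)
    (hsum : ∀ n (v : V (n + 1)), ∑ u, lam n v u = 1) {m n : ℕ} (h : m ≤ n) (y : V n → ℝ) :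
    ∑ u, projIter V lam h y u = ∑ v, y v := by
  induction n, h using Nat.le_induction with
  | base => rw [projIter_self']
  | succ n h ih => rw [projIter_succ' V lam h, ih, projStep_sum V lam hsum]

theorem projIter_nonneg (V : ℕ → Type) [∀ n, Fintype (V n)]
    (lam : ∀ n, V (n + 1) → V n → ℝ)
    (hpos : ∀ n (v : V (n + 1)) (u : V n), 0 ≤ lam n v u) {m n : ℕ} (h : m ≤ n) (y : V n → ℝ)
    (hy : ∀ v, 0 ≤ y v) (u : V m) : 0 ≤ projIter V lam h y u := by
  induction n, h using Nat.le_induction with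
  | base => rw [projIter_self']; exact hy u
  | succ n h ih =>
    rw [projIter_succ' V lam h]
    exact ih _ fun v => Finset.sum_nonneg fun w _ => mul_nonneg (hpos _ _ _) (hy w)

/-- linear map version of `projStep` -/
def projStepL (V : ℕ → Type) [∀ n, Fintype (V n)]
    (lam : ∀ n, V (n + 1) → V n → ℝ) (n : ℕ) : (V (n + 1) → ℝ) →ₗ[ℝ] (V n → ℝ) where
  toFun := projStep V lam n
  map_add' a b := by
    funext u; simp [projStep, mul_add, Finset.sum_add_distrib]
  map_smul' c a := by
    funext u; simp only [projStep, Pi.smul_apply, smul_eq_mul, RingHom.id_apply, Finset.mul_sum]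
    exact Finset.sum_congr rfl fun v _ => by ring

theorem exists_projIterL (V : ℕ → Type) [∀ n, Fintype (V n)]
    (lam : ∀ n, V (n + 1) → V n → ℝ) {m n : ℕ} (h : m ≤ n) :
    ∃ L : (V n → ℝ) →ₗ[ℝ] (V m → ℝ), ∀ y, projIter V lam h y = L y := by
  induction n, h using Nat.le_induction with
  | base => exact ⟨LinearMap.id, fun y => projIter_self' V lam _ y⟩
  | succ n h ih =>
    obtain ⟨L, hL⟩ := ih
    exact ⟨L.comp (projStepL V lam n), fun y => by rw [projIter_succ' V lam h, hL]; rfl⟩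

theorem projIter_eq_sum (V : ℕ → Type) [∀ n, Fintype (V n)] [∀ n, DecidableEq (V n)]
    (lam : ∀ n, V (n + 1) → V n → ℝ) {m n : ℕ} (h : m ≤ n) (y : V n → ℝ) (u : V m) :
    projIter V lam h y u = ∑ v, y v * projIter V lam h (vert V v) u := by
  obtain ⟨L, hL⟩ := exists_projIterL V lam h
  have hy : y = ∑ v, y v • vert V v := by
    funext w; simp [vert, Finset.sum_apply]
  simp only [hL]
  conv_lhs => rw [hy]
  simp [map_sum, Finset.sum_apply]

theorem projStep_projIter (V : ℕ → Type) [∀ n, Fintype (V n)]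
    (lam : ∀ n, V (n + 1) → V n → ℝ) {k n : ℕ} (h : k + 1 ≤ n) (h' : k ≤ n) (y : V n → ℝ) :
    projStep V lam k (projIter V lam h y) = projIter V lam h' y := by
  induction n, h using Nat.le_induction with
  | base => rw [projIter_self', projIter_succ' V lam le_rfl, projIter_self']
  | succ n h ih =>
    rw [projIter_succ' V lam h, projIter_succ' V lam (by omega : k ≤ n)]
    exact ih _ _

theorem projIter_mem (V : ℕ → Type) [∀ n, Fintype (V n)]
    (lam : ∀ n, V (n + 1) → V n → ℝ) (x : ∀ n, V n → ℝ) (hx : x ∈ SigmaInf V lam)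
    {m n : ℕ} (h : m ≤ n) : projIter V lam h (x n) = x m := by
  induction n, h using Nat.le_induction with
  | base => rw [projIter_self']
  | succ n h ih => rw [projIter_succ' V lam h, hx.2, ih]

theorem vert_mem (V : ℕ → Type) [∀ n, Fintype (V n)] [∀ n, DecidableEq (V n)] {n : ℕ} (v : V n) :
    vert V v ∈ stdSimplex ℝ (V n) := by
  refine ⟨fun u => ?_, by simp [vert]⟩
  unfold vert; split_ifs <;> norm_num

theorem projIter_vert_mem (V : ℕ → Type) [∀ n, Fintype (V n)] [∀ n, DecidableEq (V n)]
    (lam : ∀ n, V (n + 1) → V n → ℝ)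
    (hpos : ∀ n (v : V (n + 1)) (u : V n), 0 ≤ lam n v u)
    (hsum : ∀ n (v : V (n + 1)), ∑ u, lam n v u = 1) {m n : ℕ} (h : m ≤ n) (v : V n) :
    projIter V lam h (vert V v) ∈ stdSimplex ℝ (V m) :=
  ⟨projIter_nonneg V lam hpos h _ (vert_mem V v).1, by
    rw [projIter_sum V lam hsum]; exact (vert_mem V v).2⟩

/-- bounded signed perturbations of an extreme point vanish -/
theorem perturb_zero (V : ℕ → Type) [∀ n, Fintype (V n)]
    (lam : ∀ n, V (n + 1) → V n → ℝ) (x : ∀ n, V n → ℝ)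
    (hx : x ∈ Set.extremePoints ℝ (SigmaInf V lam)) (d : ∀ n, V n → ℝ)
    (hd : ∀ n v, |d n v| ≤ x n v) (hd0 : ∀ n, ∑ v, d n v = 0)
    (hdp : ∀ n, projStep V lam n (d (n + 1)) = d n) : d = 0 := by
  have h1 : x + d ∈ SigmaInf V lam := by
    refine ⟨fun n => ⟨fun v => ?_, ?_⟩, fun n => ?_⟩
    · have := abs_le.1 (hd n v)
      simp only [Pi.add_apply]; linarith
    · simp only [Pi.add_apply, Finset.sum_add_distrib, hd0, (hx.1.1 n).2, add_zero]
    · have := (projStepL V lam n).map_add (x (n + 1)) (d (n + 1))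
      change projStep V lam n (x (n + 1) + d (n + 1)) = projStep V lam n _ + projStep V lam n _
        at this
      rw [hdp, hx.1.2] at this
      exact this
  have h2 : x - d ∈ SigmaInf V lam := by
    refine ⟨fun n => ⟨fun v => ?_, ?_⟩, fun n => ?_⟩
    · have := abs_le.1 (hd n v)
      simp only [Pi.sub_apply]; linarith
    · simp only [Pi.sub_apply, Finset.sum_sub_distrib, hd0, (hx.1.1 n).2, sub_zero]
    · have := (projStepL V lam n).map_sub (x (n + 1)) (d (n + 1))
      change projStep V lam n (x (n + 1) - d (n + 1)) = projStep V lam n _ - projStep V lam n _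
        at this
      rw [hdp, hx.1.2] at this
      exact this
  have h3 : x ∈ openSegment ℝ (x + d) (x - d) := by
    refine ⟨1 / 2, 1 / 2, by norm_num, by norm_num, by norm_num, ?_⟩
    funext n v
    simp only [Pi.add_apply, Pi.smul_apply, Pi.sub_apply, smul_eq_mul]; ring
  have h4 : x + d = x := hx.2 h1 h2 h3
  simpa using h4

theorem variance_tendsto (V : ℕ → Type) [∀ n, Fintype (V n)] [∀ n, DecidableEq (V n)]
    (lam : ∀ n, V (n + 1) → V n → ℝ)
    (hpos : ∀ n (v : V (n + 1)) (u : V n), 0 ≤ lam n v u)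
    (hsum : ∀ n (v : V (n + 1)), ∑ u, lam n v u = 1)
    (x : ∀ n, V n → ℝ)
    (hx : x ∈ Set.extremePoints ℝ (SigmaInf V lam)) (m : ℕ) (u : V m) :
    Tendsto (fun n : ℕ => if h : m ≤ n then
      ∑ v : V n, x n v * (projIter V lam h (vert V v) u - x m u) ^ 2 else 0) atTop (𝓝 0) := by
  classical
  rw [tendsto_iff_ultrafilter]
  intro U hU
  have hUat : ∀ k, ∀ᶠ n in (U : Filter ℕ), k ≤ n := fun k => hU (eventually_ge_atTop k)
  have xnn : ∀ n v, 0 ≤ x n v := fun n v => (hx.1.1 n).1 v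
  have xs : ∀ n, ∑ v, x n v = 1 := fun n => (hx.1.1 n).2
  let g : ∀ n, V n → ℝ := fun n v =>
    if h : m ≤ n then projIter V lam h (vert V v) u - x m u else 0
  have hg : ∀ n v, |g n v| ≤ 1 := by
    intro n v
    simp only [g]
    split_ifs with h
    · have a := projIter_vert_mem V lam hpos hsum h v
      have a1 := a.1 u
      have a2 : projIter V lam h (vert V v) u ≤ 1 := by
        rw [← a.2]; exact Finset.single_le_sum (fun i _ => a.1 i) (Finset.mem_univ u)
      have b1 := xnn m u
      have b2 : x m u ≤ 1 := by
        rw [← xs m]; exact Finset.single_le_sum (fun i _ => xnn m i) (Finset.mem_univ u)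
      rw [abs_le]; constructor <;> linarith
    · simp
  have hg0 : ∀ n, ∑ v, x n v * g n v = 0 := by
    intro n
    by_cases h : m ≤ n
    · simp only [g, h, dif_pos, mul_sub, Finset.sum_sub_distrib]
      rw [← projIter_eq_sum, projIter_mem V lam x hx.1, ← Finset.sum_mul, xs]; ring
    · simp [g, h]
  let D : ℕ → ∀ k, V k → ℝ := fun n k =>
    if h : k ≤ n then projIter V lam h (fun v => x n v * g n v) else 0
  have hD : ∀ n k w, |D n k w| ≤ x k w := by
    intro n k w
    simp only [D]
    split_ifs with h
    · rw [projIter_eq_sum]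
      refine (Finset.abs_sum_le_sum_abs _ _).trans ?_
      rw [← projIter_mem V lam x hx.1 h, projIter_eq_sum]
      refine Finset.sum_le_sum fun v _ => ?_
      have hK := (projIter_vert_mem V lam hpos hsum h v).1 w
      rw [abs_mul, abs_mul, abs_of_nonneg hK, abs_of_nonneg (xnn n v)]
      exact mul_le_mul_of_nonneg_right (mul_le_of_le_one_right (xnn n v) (hg n v)) hK
    · simpa using xnn k w
  have hlim : ∀ k w, ∃ l, Tendsto (fun n => D n k w) U (𝓝 l) := by
    intro k w
    have hc : IsCompact (Set.Icc (-(x k w)) (x k w)) := isCompact_Icc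
    obtain ⟨l, -, hl⟩ := hc.ultrafilter_le_nhds (U.map fun n => D n k w) (by
      rw [le_principal_iff]
      exact Ultrafilter.mem_map.2 (Filter.univ_mem' fun n => abs_le.1 (hD n k w)))
    exact ⟨l, hl⟩
  choose d hd using hlim
  have hz : d = 0 := by
    refine perturb_zero V lam x hx d (fun n v => ?_) (fun n => ?_) (fun n => ?_)
    · exact le_of_tendsto (hd n v).abs (Filter.Eventually.of_forall fun k => hD k n v)
    · refine tendsto_nhds_unique (tendsto_finsetSum _ fun v _ => hd n v) ?_
      refine tendsto_const_nhds.congr' ?_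
      filter_upwards [hUat n] with k hk
      simp only [D, hk, dif_pos]
      rw [projIter_sum V lam hsum, hg0]
    · funext w
      have : Tendsto (fun k => projStep V lam n (D k (n + 1)) w) U
          (𝓝 (projStep V lam n (d (n + 1)) w)) :=
        tendsto_finsetSum _ fun v _ => (hd (n + 1) v).const_mul _
      refine tendsto_nhds_unique this ((hd n w).congr' ?_)
      filter_upwards [hUat (n + 1)] with k hk
      have hk' : n ≤ k := by omega
      simp only [D, hk, hk', dif_pos]
      rw [projStep_projIter V lam hk hk']
  have hm := hd m u
  rw [hz] at hm
  refine hm.congr' ?_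
  filter_upwards [hUat m] with n hn
  have e := hg0 n
  simp only [g, hn, dif_pos] at e
  simp only [D, g, hn, dif_pos]
  rw [projIter_eq_sum]
  rw [← sub_zero (∑ v, _), ← mul_zero (x m u), ← e, Finset.mul_sum, ← Finset.sum_sub_distrib]
  exact Finset.sum_congr rfl fun v _ => by ring

theorem cont_bound {ι : Type} [Fintype ι] (f : (ι → ℝ) → ℝ) (hf : Continuous f)
    (q : ι → ℝ) (hq : q ∈ stdSimplex ℝ ι) (ε : ℝ) (hε : 0 < ε) :
    ∃ C : ℝ, 0 ≤ C ∧ ∀ p ∈ stdSimplex ℝ ι, |f p - f q| ≤ ε + C * ∑ u, (p u - q u) ^ 2 := by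
  obtain ⟨M, hM⟩ := (isCompact_stdSimplex (𝕜 := ℝ) ι).exists_bound_of_continuousOn
    (f := fun p => f p - f q) (by fun_prop)
  have hM0 : 0 ≤ M := (norm_nonneg _).trans (hM q hq)
  obtain ⟨δ, hδ, h⟩ := Metric.continuous_iff.1 hf q ε hε
  refine ⟨M / δ ^ 2, by positivity, fun p hp => ?_⟩
  have hS : 0 ≤ ∑ u, (p u - q u) ^ 2 := Finset.sum_nonneg fun _ _ => sq_nonneg _
  by_cases hpq : dist p q < δ
  · have := (h p hpq).le
    rw [Real.dist_eq] at this
    have : 0 ≤ M / δ ^ 2 * ∑ u, (p u - q u) ^ 2 := by positivity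
    linarith
  · have h1 : ∃ u, δ ≤ |p u - q u| := by
      by_contra! hc
      exact hpq ((dist_pi_lt_iff hδ).2 fun u => by rw [Real.dist_eq]; exact hc u)
    obtain ⟨u, hu⟩ := h1
    have h2 : δ ^ 2 ≤ ∑ u, (p u - q u) ^ 2 := by
      calc δ ^ 2 ≤ |p u - q u| ^ 2 := by gcongr
        _ = (p u - q u) ^ 2 := sq_abs _
        _ ≤ _ := Finset.single_le_sum (f := fun u => (p u - q u) ^ 2)
            (fun i _ => sq_nonneg _) (Finset.mem_univ u)
    have h3 : M ≤ M / δ ^ 2 * ∑ u, (p u - q u) ^ 2 := by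
      calc M = M / δ ^ 2 * δ ^ 2 := by field_simp
        _ ≤ _ := by gcongr
    have := hM p hp
    rw [Real.norm_eq_abs] at this
    linarith

/-- a point `x` of the projective limit `Σ∞` is extreme iff for every `m` the
decomposition measures `ν_n^m = ∑_v (x n) v • δ_{π[n,m](e v)}` converge weakly, as `n → ∞`,
to the Dirac measure at `x m`; i.e. iff for every continuous `f`,
`∑_v (x n) v * f (π[n,m] (e v)) → f (x m)`. -/
theorem extremePoint_iff_weak_convergence_to_dirac
    (V : ℕ → Type) [∀ n, Fintype (V n)] [∀ n, Nonempty (V n)] [∀ n, DecidableEq (V n)]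
    (lam : ∀ n, V (n + 1) → V n → ℝ)
    (hpos : ∀ n (v : V (n + 1)) (u : V n), 0 ≤ lam n v u)
    (hsum : ∀ n (v : V (n + 1)), ∑ u, lam n v u = 1)
    (x : ∀ n, V n → ℝ) (hx : x ∈ SigmaInf V lam) :
    x ∈ Set.extremePoints ℝ (SigmaInf V lam) ↔
      ∀ (m : ℕ) (f : (V m → ℝ) → ℝ), Continuous f →
        Tendsto
          (fun n : ℕ =>
            if h : m ≤ n then ∑ v : V n, x n v * f (projIter V lam h (vert V v)) else 0)
          atTop (𝓝 (f (x m))) := by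
  constructor
  · intro hex m f hf
    have hvar : Tendsto (fun n : ℕ => ∑ u : V m, if h : m ≤ n then
        ∑ v : V n, x n v * (projIter V lam h (vert V v) u - x m u) ^ 2 else 0) atTop (𝓝 0) := by
      have := tendsto_finsetSum (Finset.univ : Finset (V m))
        fun u _ => variance_tendsto V lam hpos hsum x hex m u
      simpa using this
    rw [Metric.tendsto_nhds]
    intro ε hε
    obtain ⟨C, hC, hb⟩ := cont_bound f hf (x m) (hx.1 m) (ε / 2) (by positivity)
    have hvC := hvar.const_mul C
    rw [mul_zero] at hvC
    filter_upwards [hvC.eventually (gt_mem_nhds (half_pos hε)), eventually_ge_atTop m] with n h1 hn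
    simp only [hn, dif_pos] at h1 ⊢
    rw [Real.dist_eq]
    have xs : ∑ v, x n v = 1 := (hx.1 n).2
    have e1 : ∑ v, x n v * f (projIter V lam hn (vert V v)) - f (x m)
        = ∑ v, x n v * (f (projIter V lam hn (vert V v)) - f (x m)) := by
      simp only [mul_sub, Finset.sum_sub_distrib]
      rw [← Finset.sum_mul, xs, one_mul]
    rw [e1]
    calc |∑ v, x n v * (f (projIter V lam hn (vert V v)) - f (x m))|
        ≤ ∑ v, |x n v * (f (projIter V lam hn (vert V v)) - f (x m))| :=
          Finset.abs_sum_le_sum_abs _ _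
      _ ≤ ∑ v, x n v * (ε / 2 + C * ∑ u, (projIter V lam hn (vert V v) u - x m u) ^ 2) := by
          refine Finset.sum_le_sum fun v _ => ?_
          rw [abs_mul, abs_of_nonneg ((hx.1 n).1 v)]
          exact mul_le_mul_of_nonneg_left (hb _ (projIter_vert_mem V lam hpos hsum hn v))
            ((hx.1 n).1 v)
      _ = ε / 2 + C * ∑ u, ∑ v, x n v * (projIter V lam hn (vert V v) u - x m u) ^ 2 := by
          simp only [mul_add, Finset.sum_add_distrib]
          rw [← Finset.sum_mul, xs, one_mul, Finset.sum_comm, Finset.mul_sum]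
          congr 1
          refine Finset.sum_congr rfl fun v _ => ?_
          rw [← Finset.mul_sum]; ring
      _ < ε := by linarith
  · intro H
    refine ⟨hx, ?_⟩
    intro y hy z hz hseg
    obtain ⟨a, b, ha, hb, -, hab⟩ := hseg
    funext m u
    have ht := H m (fun p => |p u - x m u|) (by fun_prop)
    simp only [sub_self, abs_zero] at ht
    have ht2 := ht.const_mul a⁻¹
    rw [mul_zero] at ht2
    have hle : |y m u - x m u| ≤ 0 := by
      refine ge_of_tendsto ht2 ?_
      filter_upwards [eventually_ge_atTop m] with n hn
      simp only [hn, dif_pos]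
      have ys : ∑ v, y n v = 1 := (hy.1 n).2
      have e1 : y m u - x m u = ∑ v, y n v * (projIter V lam hn (vert V v) u - x m u) := by
        simp only [mul_sub, Finset.sum_sub_distrib]
        rw [← Finset.sum_mul, ys, one_mul, ← projIter_eq_sum, projIter_mem V lam y hy]
      rw [e1, Finset.mul_sum]
      refine (Finset.abs_sum_le_sum_abs _ _).trans (Finset.sum_le_sum fun v _ => ?_)
      rw [abs_mul, abs_of_nonneg ((hy.1 n).1 v), ← mul_assoc]
      refine mul_le_mul_of_nonneg_right ?_ (abs_nonneg _)
      have e2 : a * y n v + b * z n v = x n v := by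
        rw [← hab]; simp
      have e3 : 0 ≤ b * z n v := mul_nonneg hb.le ((hz.1 n).1 v)
      rw [← div_eq_inv_mul, le_div_iff₀ ha]
      linarith
    have := abs_nonpos_iff.1 hle
    linarith
end

section
/- If x ∈ Σ∞ is such that for every m : ℕ and every open set U of stdSimplex ℝ (V m) containing x m there exists an extreme point y of Σ∞ with y m ∈ U, then x belongs to the closure of the set of extreme points of Σ∞ (i.e., x is almost extreme). -/
open scoped BigOperators

theorem exists_down (V : ℕ → Type) [∀ n, Fintype (V n)]
    (lam : ∀ n, V (n + 1) → V n → ℝ) (n N : ℕ) (h : n ≤ N) :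
    ∃ f : (V N → ℝ) → (V n → ℝ), Continuous f ∧ ∀ y ∈ SigmaInf V lam, f (y N) = y n := by
  induction N, h using Nat.le_induction with
  | base => exact ⟨id, continuous_id, fun _ _ => rfl⟩
  | succ N h ih =>
    obtain ⟨f, hf, hy⟩ := ih
    refine ⟨fun z => f (projStep V lam N z), hf.comp ?_, fun y hyS => ?_⟩
    · unfold projStep
      fun_prop
    · show f (projStep V lam N (y (N + 1))) = y n
      rw [hyS.2 N, hy y hyS]

/-- if `x ∈ Σ∞` is such that for every `m` and every open set `U` containing
`x m` there is an extreme point `y` of `Σ∞` with `y m ∈ U`, then `x` lies in the closure of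
the set of extreme points of `Σ∞` (i.e., `x` is almost extreme). -/
theorem almost_extreme_of_levelwise_approximation
    (V : ℕ → Type) [∀ n, Fintype (V n)] [∀ n, Nonempty (V n)]
    (lam : ∀ n, V (n + 1) → V n → ℝ)
    (hpos : ∀ n (v : V (n + 1)) (u : V n), 0 ≤ lam n v u)
    (hsum : ∀ n (v : V (n + 1)), ∑ u, lam n v u = 1)
    (x : ∀ n, V n → ℝ) (hx : x ∈ SigmaInf V lam)
    (happrox : ∀ (m : ℕ) (U : Set (V m → ℝ)), IsOpen U → x m ∈ U →
      ∃ y ∈ Set.extremePoints ℝ (SigmaInf V lam), y m ∈ U) :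
    x ∈ closure (Set.extremePoints ℝ (SigmaInf V lam)) := by
  rw [mem_closure_iff]
  intro O hO hxO
  obtain ⟨I, u, hu, hsub⟩ := isOpen_pi_iff.1 hO x hxO
  have hle : ∀ i ∈ I, i ≤ I.sup id := fun i hi => Finset.le_sup (f := id) hi
  have key : ∀ i : I, ∃ f : (V (I.sup id) → ℝ) → (V i → ℝ), Continuous f ∧
      ∀ y ∈ SigmaInf V lam, f (y (I.sup id)) = y i :=
    fun i => exists_down V lam i _ (hle i i.2)
  choose f hf hfy using key
  obtain ⟨y, hy, hyU⟩ := happrox (I.sup id) (⋂ i : I, f i ⁻¹' (u i))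
    (isOpen_iInter_of_finite fun i => (hu i i.2).1.preimage (hf i))
    (by
      refine Set.mem_iInter.2 fun i => ?_
      rw [Set.mem_preimage, hfy i x hx]
      exact (hu i i.2).2)
  refine ⟨y, hsub fun i hi => ?_, hy⟩
  have := Set.mem_iInter.1 hyU ⟨i, hi⟩
  rw [Set.mem_preimage, hfy ⟨i, hi⟩ y hy.1] at this
  exact this
end

section
/- The map assigning to each measure μ ∈ M(λ) on the sequence space P its sequence of level marginals, x n := (fun u : V n => μ {t ∈ P | t n = u}), is a bijection from M(λ) onto the projective limit Σ∞: every μ ∈ M(λ) has its marginal sequence in Σ∞, distinct measures in M(λ) have distinct marginal sequences, and every point of Σ∞ arises as the marginal sequence of some μ ∈ M(λ). -/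
open scoped BigOperators
open MeasureTheory

/-- `M(λ)`: the set of Borel probability measures on the sequence space `P = ∏ n, V n`
with cotransition probabilities `lam`, i.e. such that for every `k` and all vertices
`u 0, …, u (k+1)`,
`μ(Cyl(u 0, …, u (k+1))) = (∏_{i ≤ k} lam i (u (i+1)) (u i)) * μ {t | t (k+1) = u (k+1)}`. -/
def Mlam (V : ℕ → Type) [∀ n, MeasurableSpace (V n)]
    (lam : ∀ n, V (n + 1) → V n → ℝ) : Set (Measure (∀ n, V n)) :=
  {μ | IsProbabilityMeasure μ ∧ ∀ (k : ℕ) (u : ∀ i, V i),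
    μ {t | ∀ i ≤ k + 1, t i = u i} =
      ENNReal.ofReal (∏ i ∈ Finset.range (k + 1), lam i (u (i + 1)) (u i)) *
        μ {t | t (k + 1) = u (k + 1)}}

/-- The sequence of level marginals of a measure `μ` on the sequence space:
`marg μ n u = μ {t | t n = u}` (as a real number). -/
noncomputable def marg (V : ℕ → Type) [∀ n, MeasurableSpace (V n)]
    (μ : Measure (∀ n, V n)) : ∀ n, V n → ℝ :=
  fun n u => (μ {t | t n = u}).toReal


lemma split_coord (V : ℕ → Type) [∀ n, Fintype (V n)]
    [∀ n, MeasurableSpace (V n)] [∀ n, DiscreteMeasurableSpace (V n)]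
    (μ : Measure (∀ n, V n)) (j : ℕ) (S : Set (∀ n, V n)) :
    μ S = ∑ w : V j, μ ({t | t j = w} ∩ S) := by
  have hm : ∀ w : V j, MeasurableSet {t : ∀ n, V n | t j = w} := fun w =>
    (measurable_pi_apply j) (measurableSet_singleton w)
  have h := sum_measure_preimage_singleton (μ := μ.restrict S) (f := fun t : ∀ n, V n => t j)
    (Finset.univ) (fun y _ => hm y)
  simp only [Finset.coe_univ, Set.preimage_univ, Measure.restrict_apply_univ] at h
  rw [← h]
  refine Finset.sum_congr rfl fun w _ => ?_
  exact Measure.restrict_apply (hm w)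

lemma cyl_reduce (V : ℕ → Type) [∀ n, Fintype (V n)]
    [∀ n, MeasurableSpace (V n)] [∀ n, DiscreteMeasurableSpace (V n)]
    (lam : ∀ n, V (n + 1) → V n → ℝ)
    (hpos : ∀ n (v : V (n + 1)) (u : V n), 0 ≤ lam n v u)
    (hsum : ∀ n (v : V (n + 1)), ∑ u, lam n v u = 1)
    (μ : Measure (∀ n, V n)) (n : ℕ) (c : V n → ENNReal)
    (h : ∀ u : ∀ i, V i, μ {t | ∀ i ≤ n, t i = u i} =
      ENNReal.ofReal (∏ i ∈ Finset.range n, lam i (u (i + 1)) (u i)) * c (u n)) (j : ℕ) :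
    j ≤ n → ∀ u : ∀ i, V i, μ {t | ∀ i, j ≤ i → i ≤ n → t i = u i} =
      ENNReal.ofReal (∏ i ∈ Finset.Ico j n, lam i (u (i + 1)) (u i)) * c (u n) := by
  induction j with
  | zero => intro _ u; simpa using h u
  | succ j ih =>
    intro hj u
    rw [split_coord V μ j]
    have key : ∀ w : V j, μ ({t | t j = w} ∩ {t | ∀ i, j + 1 ≤ i → i ≤ n → t i = u i}) =
        ENNReal.ofReal (lam j (u (j+1)) w) *
        (ENNReal.ofReal (∏ i ∈ Finset.Ico (j+1) n, lam i (u (i + 1)) (u i)) * c (u n)) := by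
      intro w
      have := ih (by omega) (Function.update u j w)
      rw [Finset.prod_eq_prod_Ico_succ_bot (by omega)] at this
      rw [Function.update_self, Function.update_of_ne (by omega), Function.update_of_ne (by omega),
        ENNReal.ofReal_mul (hpos _ _ _), mul_assoc] at this
      convert this using 2
      · ext t
        simp only [Set.mem_inter_iff, Set.mem_ofPred_eq]
        constructor
        · rintro ⟨h1, h2⟩ i hi hn
          rcases eq_or_lt_of_le hi with rfl | hlt
          · simpa using h1
          · rw [Function.update_of_ne (by omega)]; exact h2 i hlt hn
        · intro h1
          refine ⟨by simpa using h1 j le_rfl (by omega), fun i hi hn => ?_⟩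
          rw [h1 i (by omega) hn, Function.update_of_ne (by omega)]
      · congr 2
        refine Finset.prod_congr rfl fun i hi => ?_
        rw [Finset.mem_Ico] at hi
        rw [Function.update_of_ne (by omega), Function.update_of_ne (by omega)]
    simp_rw [key]
    rw [← Finset.sum_mul, ← ENNReal.ofReal_sum_of_nonneg (fun w _ => hpos _ _ _), hsum]
    simp

lemma exists_fw (V : ℕ → Type) [∀ n, Fintype (V n)] [∀ n, Nonempty (V n)]
    [∀ n, MeasurableSpace (V n)] [∀ n, DiscreteMeasurableSpace (V n)]
    (lam : ∀ n, V (n + 1) → V n → ℝ)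
    (hpos : ∀ n (v : V (n + 1)) (u : V n), 0 ≤ lam n v u)
    (x : ∀ n, V n → ℝ) (hx : x ∈ SigmaInf V lam) (n : ℕ) (u : V n) :
    ∃ m : Measure (V (n + 1)), IsProbabilityMeasure m ∧
      ∀ v, ENNReal.ofReal (x n u) * m {v} = ENNReal.ofReal (lam n v u * x (n + 1) v) := by
  classical
  obtain ⟨h1, h2⟩ := hx
  have hs : ∑ v, lam n v u * x (n + 1) v = x n u := congrFun (h2 n) u
  have h0 : ∀ v, 0 ≤ lam n v u * x (n + 1) v := fun v => mul_nonneg (hpos _ _ _) ((h1 (n+1)).1 v)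
  by_cases hz : x n u = 0
  · refine ⟨Measure.dirac (Classical.arbitrary _), inferInstance, fun v => ?_⟩
    rw [hz] at hs ⊢
    rw [(Finset.sum_eq_zero_iff_of_nonneg (fun v _ => h0 v)).1 hs v (Finset.mem_univ v)]
    simp
  · have hp : 0 < x n u := lt_of_le_of_ne ((h1 n).1 u) (Ne.symm hz)
    refine ⟨∑ v, ENNReal.ofReal (lam n v u * x (n + 1) v / x n u) • Measure.dirac v,
      ⟨?_⟩, fun v => ?_⟩
    · rw [Measure.finsetSum_apply]
      simp only [Measure.smul_apply, measure_univ, smul_eq_mul, mul_one]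
      rw [← ENNReal.ofReal_sum_of_nonneg (fun v _ => div_nonneg (h0 v) hp.le), ← Finset.sum_div, hs,
        div_self hz, ENNReal.ofReal_one]
    · rw [Measure.finsetSum_apply, Finset.sum_eq_single v]
      · simp only [Measure.smul_apply, smul_eq_mul]
        rw [Measure.dirac_apply_of_mem (Set.mem_singleton v), mul_one,
          ← ENNReal.ofReal_mul hp.le, mul_div_cancel₀ _ hz]
      · intro b _ hb
        simp [Measure.dirac_apply' _ (measurableSet_singleton v), hb]
      · simp

lemma cyl_preimage (V : ℕ → Type) (n : ℕ) (u : ∀ i, V i) :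
    {t : ∀ i, V i | ∀ i ≤ n, t i = u i} =
      Preorder.frestrictLe n ⁻¹' {Preorder.frestrictLe n u} := by
  ext t
  simp only [Set.mem_ofPred_eq, Set.mem_preimage, Set.mem_singleton_iff]
  constructor
  · intro h
    ext i
    exact h i (Finset.mem_Iic.1 i.2)
  · intro h i hi
    exact congrFun h ⟨i, Finset.mem_Iic.2 hi⟩

open ProbabilityTheory in
lemma exists_measure (V : ℕ → Type) [∀ n, Fintype (V n)] [∀ n, Nonempty (V n)]
    [∀ n, MeasurableSpace (V n)] [∀ n, DiscreteMeasurableSpace (V n)]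
    (lam : ∀ n, V (n + 1) → V n → ℝ)
    (hpos : ∀ n (v : V (n + 1)) (u : V n), 0 ≤ lam n v u)
    (x : ∀ n, V n → ℝ) (hx : x ∈ SigmaInf V lam) :
    ∃ μ : Measure (∀ n, V n), IsProbabilityMeasure μ ∧ ∀ (n : ℕ) (u : ∀ i, V i),
      μ {t | ∀ i ≤ n, t i = u i} =
      ENNReal.ofReal (∏ i ∈ Finset.range n, lam i (u (i + 1)) (u i)) *
        ENNReal.ofReal (x n (u n)) := by
  classical
  choose m hm1 hm2 using exists_fw V lam hpos x hx
  let κ : (n : ℕ) → Kernel (∀ i : Finset.Iic n, V i) (V (n + 1)) := fun n =>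
    ⟨fun t => m n (t ⟨n, Finset.mem_Iic.2 le_rfl⟩), Measurable.of_discrete⟩
  have hκ : ∀ n, IsMarkovKernel (κ n) := fun n => ⟨fun t => hm1 n _⟩
  let μ₀ : Measure (V 0) := ∑ v, ENNReal.ofReal (x 0 v) • Measure.dirac v
  have hμ₀ : ∀ v, μ₀ {v} = ENNReal.ofReal (x 0 v) := by
    intro v
    simp only [μ₀]
    rw [Measure.finsetSum_apply, Finset.sum_eq_single v]
    · simp
    · intro b _ hb
      simp [Measure.dirac_apply' _ (measurableSet_singleton v), hb]
    · simp
  have hp : IsProbabilityMeasure μ₀ := by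
    constructor
    simp only [μ₀]
    rw [Measure.finsetSum_apply]
    simp only [Measure.smul_apply, measure_univ, smul_eq_mul, mul_one]
    rw [← ENNReal.ofReal_sum_of_nonneg (fun v _ => (hx.1 0).1 v), (hx.1 0).2, ENNReal.ofReal_one]
  refine ⟨Kernel.trajMeasure μ₀ κ, inferInstance, fun n => ?_⟩
  induction n with
  | zero =>
    intro u
    rw [cyl_preimage, ← Measure.map_apply (by fun_prop) (measurableSet_singleton _),
      Kernel.trajMeasure, Measure.map_comp _ _ (by fun_prop), Kernel.traj_map_frestrictLe,
      Kernel.partialTraj_self, Measure.id_comp]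
    refine (Measure.map_apply (MeasurableEquiv.measurable _) (measurableSet_singleton _)).trans ?_
    simp only [Finset.range_zero, Finset.prod_empty, ENNReal.ofReal_one, one_mul]
    rw [← hμ₀]
    congr 1
    ext v
    exact Equiv.symm_apply_eq (Equiv.piUnique fun i : Finset.Iic 0 => V i)
  | succ n ih =>
    intro u
    have h := Kernel.map_frestrictLe_trajMeasure_compProd_eq_map_trajMeasure (μ₀ := μ₀) (κ := κ)
      (a := n)
    have h' := congrArg (fun ν => ν ({Preorder.frestrictLe n u} ×ˢ {u (n + 1)})) h
    rw [Measure.compProd_apply_prod (measurableSet_singleton _) (measurableSet_singleton _),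
      Measure.map_apply (by fun_prop)
        ((measurableSet_singleton _).prod (measurableSet_singleton _)),
      lintegral_singleton, Measure.map_apply (by fun_prop) (measurableSet_singleton _),
      ← cyl_preimage, ih u] at h'
    have hset : {t : ∀ i, V i | ∀ i ≤ n + 1, t i = u i} =
        (fun t : ∀ i, V i => (Preorder.frestrictLe (π := V) n t, t (n + 1))) ⁻¹'
          ({Preorder.frestrictLe n u} ×ˢ {u (n + 1)}) := by
      ext t
      have := Set.ext_iff.1 (cyl_preimage V n u) t
      simp only [Set.mem_preimage, Set.mem_prod, Set.mem_singleton_iff, Set.mem_ofPred_eq] at this ⊢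
      rw [← this]
      constructor
      · intro h
        exact ⟨fun i hi => h i (by omega), h _ le_rfl⟩
      · rintro ⟨h1, h2⟩ i hi
        rcases Nat.le_succ_iff.1 hi with hi | rfl
        · exact h1 i hi
        · exact h2
    rw [hset, ← h']
    have hk : κ n (Preorder.frestrictLe n u) {u (n + 1)} = m n (u n) {u (n + 1)} := rfl
    rw [hk, mul_comm, mul_assoc, hm2, Finset.prod_range_succ,
      ENNReal.ofReal_mul (hpos _ _ _),
      ENNReal.ofReal_mul (Finset.prod_nonneg fun i _ => hpos _ _ _), mul_assoc]

/-- the map `μ ↦ (marginal sequence of μ)` is a bijection from `M(λ)` onto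
the projective limit `Σ∞`. -/
theorem marginals_bijection
    (V : ℕ → Type) [∀ n, Fintype (V n)] [∀ n, Nonempty (V n)]
    [∀ n, MeasurableSpace (V n)] [∀ n, DiscreteMeasurableSpace (V n)]
    (lam : ∀ n, V (n + 1) → V n → ℝ)
    (hpos : ∀ n (v : V (n + 1)) (u : V n), 0 ≤ lam n v u)
    (hsum : ∀ n (v : V (n + 1)), ∑ u, lam n v u = 1) :
    (∀ μ ∈ Mlam V lam, marg V μ ∈ SigmaInf V lam) ∧
    (∀ μ₁ ∈ Mlam V lam, ∀ μ₂ ∈ Mlam V lam, marg V μ₁ = marg V μ₂ → μ₁ = μ₂) ∧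
    (∀ x ∈ SigmaInf V lam, ∃ μ ∈ Mlam V lam, marg V μ = x) := by
  classical
  refine ⟨?_, ?_, ?_⟩
  · rintro μ ⟨hμ, h⟩
    refine ⟨fun n => ⟨fun u => ENNReal.toReal_nonneg, ?_⟩, fun n => ?_⟩
    · have := split_coord V μ n Set.univ
      simp only [Set.inter_univ, measure_univ] at this
      simp only [marg]
      rw [← ENNReal.toReal_sum (fun _ _ => measure_ne_top _ _), ← this, ENNReal.toReal_one]
    · funext u
      simp only [projStep, marg]
      rw [split_coord V μ (n + 1) {t | t n = u}, ENNReal.toReal_sum (fun _ _ => measure_ne_top _ _)]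
      refine Finset.sum_congr rfl fun v _ => ?_
      let w : ∀ i, V i := Function.update (Function.update (fun i => Classical.arbitrary _) n u)
        (n + 1) v
      have hw1 : w (n + 1) = v := by simp [w]
      have hw0 : w n = u := by simp [w]
      have := cyl_reduce V lam hpos hsum μ (n + 1) (fun v => μ {t | t (n + 1) = v}) (h n) n
        (by omega) w
      simp only [Nat.Ico_succ_singleton, Finset.prod_singleton, hw1, hw0] at this
      have hset : {t : ∀ i, V i | ∀ i, n ≤ i → i ≤ n + 1 → t i = w i} =
          {t | t (n + 1) = v} ∩ {t | t n = u} := by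
        ext t
        simp only [Set.mem_ofPred_eq, Set.mem_inter_iff]
        constructor
        · intro h
          exact ⟨(h _ (by omega) le_rfl).trans hw1, (h _ le_rfl (by omega)).trans hw0⟩
        · rintro ⟨h1, h2⟩ i hi hi'
          obtain rfl | rfl : i = n ∨ i = n + 1 := by omega
          · rw [h2, hw0]
          · rw [h1, hw1]
      rw [← hset, this, ENNReal.toReal_mul, ENNReal.toReal_ofReal (hpos _ _ _)]
  · rintro μ₁ ⟨hμ₁, h₁⟩ μ₂ ⟨hμ₂, h₂⟩ hm
    have hlim : IsProjectiveLimit μ₂ (fun I : Finset ℕ => μ₂.map I.restrict) := fun I => rfl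
    have hfam : IsProjectiveMeasureFamily (fun I : Finset ℕ => μ₂.map (I.restrict (π := V))) := by
      intro I J hJI
      simp only
      rw [Measure.map_map (by fun_prop) (by fun_prop)]
      rfl
    have : ∀ I : Finset ℕ, IsFiniteMeasure (μ₂.map (I.restrict (π := V))) := fun I => inferInstance
    refine IsProjectiveLimit.unique (P := fun I : Finset ℕ => μ₂.map I.restrict) ?_ hlim
    rw [isProjectiveLimit_nat_iff' hfam _ 1]
    intro n hn
    obtain ⟨k, rfl⟩ : ∃ k, n = k + 1 := ⟨n - 1, by omega⟩
    refine Measure.ext_of_singleton fun a => ?_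
    obtain ⟨u, rfl⟩ : ∃ u : ∀ i, V i, Preorder.frestrictLe (k + 1) u = a := by
      refine ⟨fun i => if hi : i ∈ Finset.Iic (k + 1) then a ⟨i, hi⟩ else Classical.arbitrary _, ?_⟩
      ext i
      have := i.2
      simp only [Preorder.frestrictLe_apply]
      rw [dif_pos this]
    change _ = μ₂.map (Preorder.frestrictLe (k + 1)) _
    rw [Measure.map_apply (by fun_prop) (measurableSet_singleton _),
      Measure.map_apply (by fun_prop) (measurableSet_singleton _), ← cyl_preimage, h₁, h₂]
    congr 1
    have := congrFun (congrFun hm (k + 1)) (u (k + 1))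
    exact (ENNReal.toReal_eq_toReal_iff' (measure_ne_top _ _) (measure_ne_top _ _)).1 this
  · intro x hx
    obtain ⟨μ, hμ, h⟩ := exists_measure V lam hpos x hx
    have hmarg : ∀ n (v : V n), μ {t | t n = v} = ENNReal.ofReal (x n v) := by
      intro n v
      let w : ∀ i, V i := Function.update (fun i => Classical.arbitrary _) n v
      have hw : w n = v := by simp [w]
      have := cyl_reduce V lam hpos hsum μ n (fun v => ENNReal.ofReal (x n v)) (h n) n le_rfl w
      simp only [Finset.Ico_self, Finset.prod_empty, ENNReal.ofReal_one, one_mul, hw] at this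
      rw [← this]
      congr 1
      ext t
      simp only [Set.mem_ofPred_eq]
      constructor
      · intro h i hi hi'
        obtain rfl : i = n := by omega
        rw [h, hw]
      · intro h
        rw [h n le_rfl le_rfl, hw]
    refine ⟨μ, ⟨hμ, fun k u => ?_⟩, ?_⟩
    · rw [h, hmarg]
    · funext n v
      simp only [marg]
      rw [hmarg, ENNReal.toReal_ofReal ((hx.1 n).1 v)]
end

section
/- A measure μ ∈ M(λ) corresponds to an extreme point of the projective limit Σ∞ exactly when it is ergodic: the marginal sequence (fun n => fun u : V n => μ {t ∈ P | t n = u}) of μ is an extreme point of Σ∞ if and only if the tail σ-algebra is trivial with respect to μ, i.e., for every set A ⊆ P that is measurable with respect to the tail σ-algebra ⨅_n (the σ-algebra generated by the coordinates t k for k ≥ n), either μ A = 0 or μ A = 1. -/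
open scoped BigOperators
open MeasureTheory

/-- The tail σ-algebra on the sequence space `P = ∏ n, V n`: the infimum over `n` of the
σ-algebras generated by the coordinates `t k`, `k ≥ n`. -/
def tailSigmaAlgebra (V : ℕ → Type) [∀ n, MeasurableSpace (V n)] :
    MeasurableSpace (∀ n, V n) :=
  ⨅ n : ℕ, MeasurableSpace.comap
    (fun (t : ∀ n, V n) (k : ℕ) => t (n + k)) inferInstance


section helpers
set_option linter.unusedSectionVars false
open Filter Topology

/-- Window cylinder: coordinates `j ≤ i ≤ n` are prescribed. -/
def winCyl {V : ℕ → Type} (j n : ℕ) (u : ∀ i, V i) : Set (∀ i, V i) :=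
  {t | ∀ i, j ≤ i → i ≤ n → t i = u i}

lemma meas_coord {V : ℕ → Type} [∀ n, MeasurableSpace (V n)]
    [∀ n, DiscreteMeasurableSpace (V n)] (n : ℕ) (u : V n) :
    MeasurableSet {t : ∀ i, V i | t n = u} :=
  measurable_pi_apply n (MeasurableSet.of_discrete (s := {u}))

lemma meas_winCyl {V : ℕ → Type} [∀ n, MeasurableSpace (V n)]
    [∀ n, DiscreteMeasurableSpace (V n)] (j n : ℕ) (u : ∀ i, V i) :
    MeasurableSet (winCyl j n u) := by
  have : winCyl j n u = ⋂ i, ⋂ (_ : j ≤ i), ⋂ (_ : i ≤ n), {t : ∀ i, V i | t i = u i} := by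
    ext t; simp [winCyl]
  rw [this]
  exact MeasurableSet.iInter fun i => MeasurableSet.iInter fun _ => MeasurableSet.iInter fun _ =>
    meas_coord i (u i)

lemma ext_cyl {V : ℕ → Type} [∀ n, Fintype (V n)] [∀ n, Nonempty (V n)]
    [∀ n, MeasurableSpace (V n)] [∀ n, DiscreteMeasurableSpace (V n)]
    (ν₁ ν₂ : Measure (∀ n, V n)) [IsFiniteMeasure ν₁] [IsFiniteMeasure ν₂]
    (h : ∀ k (u : ∀ i, V i), ν₁ (winCyl 0 k u) = ν₂ (winCyl 0 k u)) : ν₁ = ν₂ := by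
  classical
  have hp : IsProjectiveMeasureFamily (fun I : Finset ℕ => ν₂.map I.restrict) := by
    intro I J hJI
    rw [Measure.map_map (by fun_prop) (by fun_prop)]
    rfl
  have h2 : IsProjectiveLimit ν₂ (fun I : Finset ℕ => ν₂.map I.restrict) := fun I => rfl
  have h1 : IsProjectiveLimit ν₁ (fun I : Finset ℕ => ν₂.map I.restrict) := by
    rw [isProjectiveLimit_nat_iff hp]
    intro n
    refine Measure.ext_of_singleton fun w => ?_
    have hm : MeasurableSet ({w} : Set (∀ i : Finset.Iic n, V i)) := measurableSet_singleton w
    rw [Measure.map_apply (Preorder.measurable_frestrictLe n) hm, Measure.map_apply (by fun_prop) hm]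
    let u : ∀ i, V i := fun i => if hi : i ∈ Finset.Iic n then w ⟨i, hi⟩ else Classical.arbitrary _
    have e : (Preorder.frestrictLe n ⁻¹' {w} : Set (∀ i, V i)) = winCyl 0 n u := by
      ext t
      simp only [Set.mem_preimage, Set.mem_singleton_iff, winCyl, Set.mem_ofPred_eq]
      constructor
      · rintro h i - hi
        have := congrFun h ⟨i, Finset.mem_Iic.2 hi⟩
        simpa [u, hi] using this
      · intro h
        funext ⟨i, hi⟩
        have := h i (Nat.zero_le _) (Finset.mem_Iic.1 hi)
        simp only [u, hi, dite_true] at this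
        exact this
    have e' : (Finset.restrict (Finset.Iic n) ⁻¹' {w} : Set (∀ i, V i)) = winCyl 0 n u := e
    rw [e, e', h]
  exact h1.unique h2

lemma real_split {V : ℕ → Type} [∀ n, Fintype (V n)]
    [∀ n, MeasurableSpace (V n)] [∀ n, DiscreteMeasurableSpace (V n)]
    (μ : Measure (∀ n, V n)) [IsFiniteMeasure μ] (S : Set (∀ n, V n)) (hS : MeasurableSet S)
    (j : ℕ) : μ.real S = ∑ w : V j, μ.real ({t | t j = w} ∩ S) := by
  rw [← measureReal_biUnion_finset]
  · congr 1; ext t; simp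
  · intro a _ b _ hab
    refine Set.disjoint_left.2 ?_
    rintro t ⟨h1, _⟩ ⟨h2, _⟩
    exact hab (h1.symm.trans h2)
  · exact fun w _ => (meas_coord j w).inter hS

variable {V : ℕ → Type} [∀ n, Fintype (V n)] [∀ n, Nonempty (V n)]
    [∀ n, MeasurableSpace (V n)] [∀ n, DiscreteMeasurableSpace (V n)]
    {lam : ∀ n, V (n + 1) → V n → ℝ}

lemma win_formula (hpos : ∀ n (v : V (n + 1)) (u : V n), 0 ≤ lam n v u)
    (hsum : ∀ n (v : V (n + 1)), ∑ u, lam n v u = 1)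
    (μ : Measure (∀ n, V n)) (hμ : μ ∈ Mlam V lam) (j n : ℕ) (hjn : j ≤ n) (u : ∀ i, V i) :
    μ.real (winCyl j n u) = (∏ i ∈ Finset.Ico j n, lam i (u (i + 1)) (u i)) *
      μ.real {t | t n = u n} := by
  classical
  have := hμ.1
  induction j generalizing u with
  | zero =>
    cases n with
    | zero => simp [winCyl]
    | succ k =>
      have h := hμ.2 k u
      have e : winCyl 0 (k+1) u = {t | ∀ i ≤ k + 1, t i = u i} := by ext; simp [winCyl]
      rw [measureReal_def, e, h, ENNReal.toReal_mul, ENNReal.toReal_ofReal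
        (Finset.prod_nonneg fun i _ => hpos _ _ _), Finset.range_eq_Ico]
      rfl
  | succ j ih =>
    rw [real_split μ _ (meas_winCyl _ _ _) j]
    have key : ∀ w : V j, μ.real ({t | t j = w} ∩ winCyl (j+1) n u) =
        lam j (u (j+1)) w * ((∏ i ∈ Finset.Ico (j+1) n, lam i (u (i + 1)) (u i)) *
      μ.real {t | t n = u n}) := by
      intro w
      have hu : ∀ i, i ≠ j → Function.update u j w i = u i := fun i hi =>
        Function.update_of_ne hi _ _
      have e : {t | t j = w} ∩ winCyl (j+1) n u = winCyl j n (Function.update u j w) := by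
        ext t
        simp only [winCyl, Set.mem_inter_iff, Set.mem_ofPred_eq]
        constructor
        · rintro ⟨h1, h2⟩ i hi hin
          by_cases hij : i = j
          · subst hij; simpa using h1
          · rw [hu i hij]; exact h2 i (by omega) hin
        · intro h
          refine ⟨by simpa using h j le_rfl (by omega), fun i hi hin => ?_⟩
          rw [← hu i (by omega)]; exact h i (by omega) hin
      rw [e, ih (by omega), hu n (by omega), Finset.prod_eq_prod_Ico_succ_bot (by omega),
        hu (j+1) (by omega), Function.update_self, mul_assoc]
      congr 2
      refine Finset.prod_congr rfl fun i hi => ?_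
      have := (Finset.mem_Ico.1 hi).1
      rw [hu (i+1) (by omega), hu i (by omega)]
    rw [Finset.sum_congr rfl fun w _ => key w, ← Finset.sum_mul, hsum, one_mul]

/-- Cotransition formula intersected with events depending on coordinates `≥ n`. -/
lemma win_formula_tail (hpos : ∀ n (v : V (n + 1)) (u : V n), 0 ≤ lam n v u)
    (hsum : ∀ n (v : V (n + 1)), ∑ u, lam n v u = 1)
    (μ : Measure (∀ n, V n)) (hμ : μ ∈ Mlam V lam) (j n : ℕ) (hjn : j ≤ n) (u : ∀ i, V i)
    (A : Set (∀ n, V n)) (hA : MeasurableSet[MeasurableSpace.comap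
    (fun (t : ∀ n, V n) (k : ℕ) => t (n + k)) inferInstance] A) :
    μ.real (winCyl j n u ∩ A) = (∏ i ∈ Finset.Ico j n, lam i (u (i + 1)) (u i)) *
      μ.real ({t | t n = u n} ∩ A) := by
  classical
  have := hμ.1
  obtain ⟨B, hB, rfl⟩ := hA
  set sh : (∀ n, V n) → (∀ k, V (n + k)) := fun t k => t (n + k) with hsh
  have hshm : Measurable sh := by
    rw [measurable_pi_iff]; intro k; exact measurable_pi_apply _
  set c := ∏ i ∈ Finset.Ico j n, lam i (u (i + 1)) (u i) with hc
  have hc0 : 0 ≤ c := Finset.prod_nonneg fun i _ => hpos _ _ _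
  have main : (μ.restrict (winCyl j n u)).map sh =
      (ENNReal.ofReal c) • (μ.restrict {t | t n = u n}).map sh := by
    have : IsFiniteMeasure ((ENNReal.ofReal c) • (μ.restrict {t | t n = u n}).map sh) :=
      Measure.smul_finite _ ENNReal.ofReal_ne_top
    refine ext_cyl (V := fun k => V (n + k)) _ _ fun k w => ?_
    have hm := meas_winCyl (V := fun k => V (n + k)) 0 k w
    rw [Measure.smul_apply, Measure.map_apply hshm hm, Measure.map_apply hshm hm,
      Measure.restrict_apply (hshm hm), Measure.restrict_apply (hshm hm), smul_eq_mul]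
    by_cases hne : ∃ t1, t1 ∈ sh ⁻¹' (winCyl (V := fun k => V (n + k)) 0 k w) ∩ {t | t n = u n}
    · obtain ⟨t1, h1, h1n⟩ := hne
      let z : ∀ i, V i := fun i => if i < n then u i else t1 i
      have zu : ∀ i, i ≤ n → z i = u i := by
        intro i hi
        rcases hi.lt_or_eq with h | rfl
        · simp [z, h]
        · simpa [z] using h1n
      have zt : ∀ i, n ≤ i → z i = t1 i := fun i hi => by simp [z, hi]
      have zw : ∀ i, i ≤ k → z (n + i) = w i := fun i hi => by
        rw [zt _ (by omega)]; exact h1 i (Nat.zero_le _) hi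
      have e1 : sh ⁻¹' (winCyl (V := fun k => V (n + k)) 0 k w) ∩ winCyl j n u =
          winCyl j (n + k) z := by
        ext t
        simp only [winCyl, Set.mem_inter_iff, Set.mem_preimage, Set.mem_ofPred_eq, hsh]
        constructor
        · rintro ⟨ha, hb⟩ i hi hi'
          by_cases hin : i ≤ n
          · rw [zu i hin]; exact hb i hi hin
          · obtain ⟨m, rfl⟩ := Nat.exists_eq_add_of_le (show n ≤ i by omega)
            rw [zw m (by omega)]; exact ha m (Nat.zero_le _) (by omega)
        · intro h
          refine ⟨fun i _ hi => ?_, fun i hi hin => ?_⟩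
          · rw [← zw i hi]; exact h _ (by omega) (by omega)
          · rw [← zu i hin]; exact h _ (by omega) (by omega)
      have e2 : sh ⁻¹' (winCyl (V := fun k => V (n + k)) 0 k w) ∩ {t | t n = u n} =
          winCyl n (n + k) z := by
        ext t
        simp only [winCyl, Set.mem_inter_iff, Set.mem_preimage, Set.mem_ofPred_eq, hsh]
        constructor
        · rintro ⟨ha, hb⟩ i hi hi'
          obtain ⟨m, rfl⟩ := Nat.exists_eq_add_of_le hi
          rw [zw m (by omega)]; exact ha m (Nat.zero_le _) (by omega)
        · intro h
          refine ⟨fun i _ hi => ?_, ?_⟩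
          · rw [← zw i hi]; exact h _ (by omega) (by omega)
          · rw [← zu n le_rfl]; exact h _ (by omega) (by omega)
      have hcz : c = ∏ i ∈ Finset.Ico j n, lam i (z (i + 1)) (z i) := by
        refine Finset.prod_congr rfl fun i hi => ?_
        have := (Finset.mem_Ico.1 hi).2
        rw [zu i (by omega), zu (i+1) (by omega)]
      rw [e1, e2, ← ENNReal.toReal_eq_toReal_iff' (measure_ne_top _ _)
        (ENNReal.mul_ne_top ENNReal.ofReal_ne_top (measure_ne_top _ _)), ENNReal.toReal_mul,
        ENNReal.toReal_ofReal hc0, ← measureReal_def, ← measureReal_def,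
        win_formula hpos hsum μ hμ j (n+k) (by omega), win_formula hpos hsum μ hμ n (n+k) (by omega),
        ← mul_assoc, hcz, Finset.prod_Ico_consecutive _ hjn (by omega)]
    · have e2 := Set.not_nonempty_iff_eq_empty.1 hne
      have e1 : sh ⁻¹' (winCyl (V := fun k => V (n + k)) 0 k w) ∩ winCyl j n u = ∅ := by
        rw [← Set.not_nonempty_iff_eq_empty]
        rintro ⟨t, ht, ht'⟩
        exact hne ⟨t, ht, ht' n hjn le_rfl⟩
      rw [e1, e2]; simp
  have h := congrArg (fun ν => (ν B).toReal) main
  simp only [Measure.smul_apply] at h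
  rw [Measure.map_apply hshm hB, Measure.map_apply hshm hB,
      Measure.restrict_apply (hshm hB), Measure.restrict_apply (hshm hB), smul_eq_mul,
      ENNReal.toReal_mul, ENNReal.toReal_ofReal hc0] at h
  rw [Set.inter_comm, Set.inter_comm (a := {t : ∀ n, V n | t n = u n})]
  exact h

lemma one_step (hpos : ∀ n (v : V (n + 1)) (u : V n), 0 ≤ lam n v u)
    (hsum : ∀ n (v : V (n + 1)), ∑ u, lam n v u = 1)
    (μ : Measure (∀ n, V n)) (hμ : μ ∈ Mlam V lam) (A : Set (∀ n, V n))
    (hAm : MeasurableSet A) (n : ℕ) (hA : MeasurableSet[MeasurableSpace.comap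
    (fun (t : ∀ n, V n) (k : ℕ) => t (n + 1 + k)) inferInstance] A) (u : V n) :
    ∑ v, lam n v u * μ.real ({t | t (n+1) = v} ∩ A) = μ.real ({t | t n = u} ∩ A) := by
  classical
  have := hμ.1
  rw [real_split μ ({t | t n = u} ∩ A) ((meas_coord n u).inter hAm) (n+1)]
  refine Finset.sum_congr rfl fun v _ => ?_
  let z : ∀ i, V i := Function.update (Function.update (fun i => Classical.arbitrary _) n u) (n+1) v
  have z1 : z (n+1) = v := by simp [z]
  have z0 : z n = u := by simp [z]
  have h := win_formula_tail hpos hsum μ hμ n (n+1) (by omega) z A hA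
  have e : winCyl n (n+1) z = {t | t (n+1) = v} ∩ {t | t n = u} := by
    ext t
    simp only [winCyl, Set.mem_inter_iff, Set.mem_ofPred_eq]
    constructor
    · intro h
      exact ⟨by rw [← z1]; exact h _ (by omega) le_rfl, by rw [← z0]; exact h _ le_rfl (by omega)⟩
    · rintro ⟨h1, h0⟩ i hi hi'
      obtain rfl | rfl : i = n ∨ i = n + 1 := by omega
      · rw [z0]; exact h0
      · rw [z1]; exact h1
  rw [e, Set.inter_assoc] at h
  rw [h]
  simp [z0, z1]

lemma tail_le (n : ℕ) : tailSigmaAlgebra V ≤ MeasurableSpace.comap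
    (fun (t : ∀ n, V n) (k : ℕ) => t (n + k)) inferInstance := iInf_le _ n

lemma comap_shift_le (n : ℕ) : MeasurableSpace.comap
    (fun (t : ∀ n, V n) (k : ℕ) => t (n + k)) inferInstance ≤ MeasurableSpace.pi := by
  have : Measurable (fun (t : ∀ n, V n) (k : ℕ) => t (n + k)) := by
    rw [measurable_pi_iff]; intro k; exact measurable_pi_apply _
  exact this.comap_le

lemma cond_mem (hpos : ∀ n (v : V (n + 1)) (u : V n), 0 ≤ lam n v u)
    (hsum : ∀ n (v : V (n + 1)), ∑ u, lam n v u = 1)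
    (μ : Measure (∀ n, V n)) (hμ : μ ∈ Mlam V lam) (A : Set (∀ n, V n))
    (hA : MeasurableSet[tailSigmaAlgebra V] A) (h0 : μ.real A ≠ 0) :
    (fun n u => μ.real ({t | t n = u} ∩ A) / μ.real A) ∈ SigmaInf V lam := by
  have := hμ.1
  have hAm : MeasurableSet A := comap_shift_le 0 _ (tail_le 0 _ hA)
  refine ⟨fun n => ⟨fun u => by positivity, ?_⟩, fun n => ?_⟩
  · rw [← Finset.sum_div, ← real_split μ A hAm n, div_self h0]
  · funext u
    simp only [projStep]
    rw [← one_step hpos hsum μ hμ A hAm n (tail_le (n+1) _ hA) u, Finset.sum_div]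
    exact Finset.sum_congr rfl fun v _ => by ring

lemma forward (hpos : ∀ n (v : V (n + 1)) (u : V n), 0 ≤ lam n v u)
    (hsum : ∀ n (v : V (n + 1)), ∑ u, lam n v u = 1)
    (μ : Measure (∀ n, V n)) (hμ : μ ∈ Mlam V lam)
    (hext : marg V μ ∈ Set.extremePoints ℝ (SigmaInf V lam)) (A : Set (∀ n, V n))
    (hA : MeasurableSet[tailSigmaAlgebra V] A) : μ A = 0 ∨ μ A = 1 := by
  have := hμ.1
  by_contra! hcon
  have hAm : MeasurableSet A := comap_shift_le 0 _ (tail_le 0 _ hA)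
  have ha0 : μ.real A ≠ 0 := by
    rw [measureReal_def]; simp [ENNReal.toReal_eq_zero_iff, hcon.1]
  have hac : μ.real Aᶜ = 1 - μ.real A := probReal_compl_eq_one_sub hAm
  have ha1 : μ.real A ≠ 1 := by
    rw [measureReal_def]; simp [ENNReal.toReal_eq_one_iff, hcon.2]
  have hle : μ.real A ≤ 1 := measureReal_le_one
  have hpA : 0 < μ.real A := lt_of_le_of_ne measureReal_nonneg ha0.symm
  have hpc : 0 < 1 - μ.real A := by
    have := lt_of_le_of_ne hle ha1; linarith
  have hx := cond_mem hpos hsum μ hμ A hA ha0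
  have hy := cond_mem hpos hsum μ hμ Aᶜ (MeasurableSet.compl hA) (by rw [hac]; exact hpc.ne')
  have heq := hext.2 hx hy ⟨μ.real A, 1 - μ.real A, hpA, hpc, by ring, by
    funext n u
    simp only [Pi.add_apply, Pi.smul_apply, smul_eq_mul, hac]
    rw [mul_div_cancel₀ _ ha0, mul_div_cancel₀ _ hpc.ne']
    exact measureReal_inter_add_sdiff hAm⟩
  have h2 : ∀ n (u : V n), μ.real ({t | t n = u} ∩ A) = μ.real A * μ.real {t | t n = u} := by
    intro n u
    have := congrFun (congrFun heq n) u
    simp only [marg] at this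
    rw [div_eq_iff ha0] at this
    rw [this, mul_comm]; rfl
  have : IsFiniteMeasure (μ A • μ) := Measure.smul_finite _ (measure_ne_top _ _)
  have h3 : μ.restrict A = μ A • μ := by
    refine ext_cyl _ _ fun n u => ?_
    rw [Measure.restrict_apply (meas_winCyl _ _ _), Measure.smul_apply, smul_eq_mul,
      ← ENNReal.toReal_eq_toReal_iff' (measure_ne_top _ _)
        (ENNReal.mul_ne_top (measure_ne_top _ _) (measure_ne_top _ _)), ENNReal.toReal_mul,
      ← measureReal_def, ← measureReal_def, ← measureReal_def,
      win_formula_tail hpos hsum μ hμ 0 n (Nat.zero_le _) u A (tail_le n _ hA),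
      win_formula hpos hsum μ hμ 0 n (Nat.zero_le _) u, h2]
    ring
  have h4 := congrArg (fun ν => (ν A).toReal) h3
  simp only [Measure.restrict_apply_self, Measure.smul_apply, smul_eq_mul, ENNReal.toReal_mul,
    ← measureReal_def] at h4
  apply ha1
  field_simp at h4
  linarith

lemma cyl_step (n : ℕ) (u : ∀ i, V i) (v : V (n + 1)) :
    {t | t (n + 1) = v} ∩ winCyl 0 n u = winCyl 0 (n + 1) (Function.update u (n + 1) v) := by
  have hu : ∀ i, i ≠ n + 1 → Function.update u (n + 1) v i = u i := fun i hi =>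
    Function.update_of_ne hi _ _
  ext t
  simp only [winCyl, Set.mem_inter_iff, Set.mem_ofPred_eq]
  constructor
  · rintro ⟨h1, h2⟩ i hi hin
    by_cases hij : i = n + 1
    · subst hij; simpa using h1
    · rw [hu i hij]; exact h2 i hi (by omega)
  · intro h
    refine ⟨by simpa using h (n + 1) (Nat.zero_le _) le_rfl, fun i hi hin => ?_⟩
    rw [← hu i (by omega)]; exact h i (by omega) (by omega)

/-- Relative density of `x` with respect to the marginals of `μ`. -/
noncomputable def dens (μ : Measure (∀ n, V n)) (x : ∀ n, V n → ℝ) (n : ℕ) (t : ∀ n, V n) : ℝ :=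
  x n (t n) / μ.real {s | s n = t n}

lemma dens_eq (μ : Measure (∀ n, V n)) (x : ∀ n, V n → ℝ) (n : ℕ) :
    dens μ x n = (fun w : V n => x n w / μ.real {s | s n = w}) ∘ (fun t => t n) := rfl

lemma dens_meas (μ : Measure (∀ n, V n)) (x : ∀ n, V n → ℝ) (n : ℕ) :
    Measurable (dens μ x n) := by
  rw [dens_eq]
  exact (measurable_of_finite _).comp (measurable_pi_apply n)

lemma dens_bound (μ : Measure (∀ n, V n)) (x : ∀ n, V n → ℝ)
    (hx0 : ∀ n u, 0 ≤ x n u) {K : ℝ} (hK : 0 ≤ K)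
    (hxK : ∀ n u, x n u ≤ K * μ.real {s : ∀ n, V n | s n = u}) (n : ℕ) (t : ∀ n, V n) :
    ‖dens μ x n t‖ ≤ K := by
  unfold dens
  rw [Real.norm_of_nonneg (div_nonneg (hx0 _ _) measureReal_nonneg)]
  exact div_le_of_le_mul₀ measureReal_nonneg hK (hxK _ _)

lemma dens_setInt (μ : Measure (∀ n, V n)) [IsFiniteMeasure μ] (x : ∀ n, V n → ℝ) (n : ℕ)
    (v : V n) (S : Set (∀ n, V n)) (hS : MeasurableSet S) (hSv : ∀ t ∈ S, t n = v) :
    ∫ t in S, dens μ x n t ∂μ = x n v / μ.real {s | s n = v} * μ.real S := by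
  rw [setIntegral_congr_fun (g := fun _ => x n v / μ.real {s | s n = v}) hS
    (fun t ht => by simp only [dens]; rw [hSv t ht]), setIntegral_const, smul_eq_mul, mul_comm]

lemma dens_int (μ : Measure (∀ n, V n)) [IsFiniteMeasure μ] (x : ∀ n, V n → ℝ)
    (hx0 : ∀ n u, 0 ≤ x n u) {K : ℝ} (hK : 0 ≤ K)
    (hxK : ∀ n u, x n u ≤ K * μ.real {s : ∀ n, V n | s n = u}) (n : ℕ) :
    Integrable (dens μ x n) μ :=
  Integrable.of_bound (dens_meas μ x n).aestronglyMeasurable K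
    (Filter.Eventually.of_forall (dens_bound μ x hx0 hK hxK n))

lemma dens_coord (μ : Measure (∀ n, V n)) [IsFiniteMeasure μ] (x : ∀ n, V n → ℝ)
    (hx0 : ∀ n u, 0 ≤ x n u) {K : ℝ}
    (hxK : ∀ n u, x n u ≤ K * μ.real {s : ∀ n, V n | s n = u}) (n : ℕ) (v : V n) :
    x n v / μ.real {s | s n = v} * μ.real {s | s n = v} = x n v := by
  by_cases h : μ.real {s : ∀ n, V n | s n = v} = 0
  · have := hxK n v
    rw [h, mul_zero] at this
    rw [h, mul_zero]; exact le_antisymm (hx0 _ _) this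
  · exact div_mul_cancel₀ _ h

lemma dens_cyl (hpos : ∀ n (v : V (n + 1)) (u : V n), 0 ≤ lam n v u)
    (hsum : ∀ n (v : V (n + 1)), ∑ u, lam n v u = 1)
    (μ : Measure (∀ n, V n)) (hμ : μ ∈ Mlam V lam) (x : ∀ n, V n → ℝ)
    (hx0 : ∀ n u, 0 ≤ x n u) {K : ℝ}
    (hxK : ∀ n u, x n u ≤ K * μ.real {s : ∀ n, V n | s n = u}) (n : ℕ) (u : ∀ i, V i) :
    ∫ t in winCyl 0 n u, dens μ x n t ∂μ =
      (∏ i ∈ Finset.Ico 0 n, lam i (u (i + 1)) (u i)) * x n (u n) := by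
  have := hμ.1
  rw [dens_setInt μ x n (u n) _ (meas_winCyl _ _ _) (fun t ht => ht n (Nat.zero_le _) le_rfl),
    win_formula hpos hsum μ hμ 0 n (Nat.zero_le _), mul_left_comm, dens_coord μ x hx0 hxK]

lemma dens_cyl_succ (hpos : ∀ n (v : V (n + 1)) (u : V n), 0 ≤ lam n v u)
    (hsum : ∀ n (v : V (n + 1)), ∑ u, lam n v u = 1)
    (μ : Measure (∀ n, V n)) (hμ : μ ∈ Mlam V lam) (x : ∀ n, V n → ℝ)
    (hx0 : ∀ n u, 0 ≤ x n u) {K : ℝ} (hK : 0 ≤ K)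
    (hxK : ∀ n u, x n u ≤ K * μ.real {s : ∀ n, V n | s n = u})
    (hxp : ∀ n, projStep V lam n (x (n + 1)) = x n) (n : ℕ) (u : ∀ i, V i) :
    ∫ t in winCyl 0 n u, dens μ x n t ∂μ = ∫ t in winCyl 0 n u, dens μ x (n + 1) t ∂μ := by
  have := hμ.1
  rw [dens_cyl hpos hsum μ hμ x hx0 hxK]
  have e : winCyl 0 n u = ⋃ v ∈ (Finset.univ : Finset (V (n+1))),
      winCyl 0 (n + 1) (Function.update u (n + 1) v) := by
    simp_rw [← cyl_step]
    ext t; simp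
  conv_rhs => rw [e]
  rw [integral_biUnion_finset]
  · rw [← congrFun (hxp n) (u n), projStep, Finset.mul_sum]
    refine Finset.sum_congr rfl fun v _ => ?_
    have hu : ∀ i, i ≠ n + 1 → Function.update u (n + 1) v i = u i := fun i hi =>
      Function.update_of_ne hi _ _
    rw [dens_cyl hpos hsum μ hμ x hx0 hxK, Finset.prod_Ico_succ_top (Nat.zero_le _),
      Function.update_self, hu n (by omega), mul_assoc]
    congr 1
    refine Finset.prod_congr rfl fun i hi => ?_
    have := (Finset.mem_Ico.1 hi).2
    rw [hu i (by omega), hu (i+1) (by omega)]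
  · exact fun v _ => meas_winCyl _ _ _
  · intro a _ b _ hab
    simp only [Function.onFun, ← cyl_step]
    refine Set.disjoint_left.2 ?_
    rintro t ⟨h1, _⟩ ⟨h2, _⟩
    exact hab (h1.symm.trans h2)
  · exact fun v _ => (dens_int μ x hx0 hK hxK (n+1)).integrableOn

lemma dens_mart (hpos : ∀ n (v : V (n + 1)) (u : V n), 0 ≤ lam n v u)
    (hsum : ∀ n (v : V (n + 1)), ∑ u, lam n v u = 1)
    (μ : Measure (∀ n, V n)) (hμ : μ ∈ Mlam V lam) (x : ∀ n, V n → ℝ)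
    (hx0 : ∀ n u, 0 ≤ x n u) {K : ℝ} (hK : 0 ≤ K)
    (hxK : ∀ n u, x n u ≤ K * μ.real {s : ∀ n, V n | s n = u})
    (hxp : ∀ n, projStep V lam n (x (n + 1)) = x n) :
    Martingale (dens μ x) (Filtration.piLE (X := V)) μ := by
  classical
  have := hμ.1
  refine martingale_of_setIntegral_eq_succ ?_ (dens_int μ x hx0 hK hxK) ?_
  · intro n
    apply Measurable.stronglyMeasurable
    have e : dens μ x n = ((fun w : V n => x n w / μ.real {s | s n = w}) ∘
      (fun w : (∀ i : Set.Iic n, V i) => w ⟨n, Set.mem_Iic.2 le_rfl⟩)) ∘ Preorder.restrictLe n := rfl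
    rw [e]
    have hev : Measurable (fun w : (∀ i : Set.Iic n, V i) => w ⟨n, Set.mem_Iic.2 le_rfl⟩) :=
        measurable_pi_apply (X := fun i : Set.Iic n => V i) _
    exact ((measurable_of_finite _).comp hev).comp (comap_measurable _)
  · rintro n s ⟨T, -, rfl⟩
    let ext : (∀ i : Set.Iic n, V i) → ∀ i, V i := fun w i =>
      if hi : i ∈ Set.Iic n then w ⟨i, hi⟩ else Classical.arbitrary _
    have hw : ∀ w : (∀ i : Set.Iic n, V i), winCyl 0 n (ext w) =
        Preorder.restrictLe (π := V) n ⁻¹' {w} := by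
      intro w
      ext t
      simp only [Set.mem_preimage, Set.mem_singleton_iff, winCyl, Set.mem_ofPred_eq]
      constructor
      · intro h
        funext ⟨i, hi⟩
        have := h i (Nat.zero_le _) hi
        simp only [ext, hi, dite_true] at this
        exact this
      · rintro h i - hi
        have := congrFun h ⟨i, hi⟩
        simp only [ext, Set.mem_Iic, hi, dite_true]
        exact this
    have e : Preorder.restrictLe (π := V) n ⁻¹' T =
        ⋃ w ∈ T.toFinite.toFinset, winCyl 0 n (ext w) := by
      simp_rw [hw]
      ext t; simp
    have hd : (↑T.toFinite.toFinset : Set (∀ i : Set.Iic n, V i)).Pairwise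
        (Function.onFun Disjoint fun w => winCyl 0 n (ext w)) := by
      intro a _ b _ hab
      simp only [Function.onFun, hw]
      exact Disjoint.preimage _ (by simpa using hab)
    rw [e, integral_biUnion_finset _ (fun w _ => meas_winCyl _ _ _) hd
        (fun v _ => (dens_int μ x hx0 hK hxK n).integrableOn),
      integral_biUnion_finset _ (fun w _ => meas_winCyl _ _ _) hd
        (fun v _ => (dens_int μ x hx0 hK hxK (n+1)).integrableOn)]
    exact Finset.sum_congr rfl fun w _ => dens_cyl_succ hpos hsum μ hμ x hx0 hK hxK hxp n _

lemma backward_aux (hpos : ∀ n (v : V (n + 1)) (u : V n), 0 ≤ lam n v u)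
    (hsum : ∀ n (v : V (n + 1)), ∑ u, lam n v u = 1)
    (μ : Measure (∀ n, V n)) (hμ : μ ∈ Mlam V lam)
    (htriv : ∀ A : Set (∀ n, V n), MeasurableSet[tailSigmaAlgebra V] A → μ A = 0 ∨ μ A = 1)
    (x : ∀ n, V n → ℝ) (hx : x ∈ SigmaInf V lam) {K : ℝ} (hK : 0 ≤ K)
    (hxK : ∀ n u, x n u ≤ K * μ.real {s : ∀ n, V n | s n = u}) :
    x = marg V μ := by
  classical
  have := hμ.1
  have hx0 : ∀ n u, 0 ≤ x n u := fun n u => (hx.1 n).1 u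
  have hM := dens_mart hpos hsum μ hμ x hx0 hK hxK hx.2
  have hconv : ∀ᵐ t ∂μ, ∃ c, Tendsto (fun n => dens μ x n t) atTop (𝓝 c) := by
    refine hM.submartingale.exists_ae_tendsto_of_bdd (R := K.toNNReal) fun n => ?_
    refine (eLpNorm_le_of_ae_bound (Filter.Eventually.of_forall
      (dens_bound μ x hx0 hK hxK n))).trans ?_
    simp [ENNReal.ofReal]
  -- the limit function
  let f : (∀ n, V n) → ℝ := fun t => limsup (fun n => dens μ x n t) atTop
  have hf : ∀ᵐ t ∂μ, Tendsto (fun n => dens μ x n t) atTop (𝓝 (f t)) := by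
    filter_upwards [hconv] with t ⟨c, hc⟩
    have : f t = c := hc.limsup_eq
    rwa [this]
  have hfm : Measurable[tailSigmaAlgebra V] f := by
    intro s hs
    refine MeasurableSpace.measurableSet_iInf.2 fun N => ?_
    have e : f = (fun r : (∀ k, V (N + k)) => limsup (fun k => x (N + k) (r k) /
        μ.real {s : ∀ n, V n | s (N + k) = r k}) atTop) ∘ (fun t k => t (N + k)) := by
      funext t
      simp only [f, Function.comp]
      rw [← Filter.limsup_nat_add _ N]
      congr 1
      funext i
      rw [add_comm i N]
      rfl
    rw [e]
    have hm : Measurable (fun r : (∀ k, V (N + k)) => limsup (fun k => x (N + k) (r k) /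
        μ.real {s : ∀ n, V n | s (N + k) = r k}) atTop) := by
      refine Measurable.limsup fun k => ?_
      exact (measurable_of_finite (fun w : V (N + k) => x (N + k) w /
        μ.real {s : ∀ n, V n | s (N + k) = w})).comp (measurable_pi_apply k)
    exact ⟨_, hm hs, rfl⟩
  obtain ⟨c, hc⟩ : ∃ c, f =ᵐ[μ] Function.const _ c := by
    refine Filter.exists_eventuallyEq_const_of_forall_separating MeasurableSet fun U hU => ?_
    rcases htriv _ (hfm hU) with h | h
    · right
      exact measure_eq_zero_iff_ae_notMem.1 h
    · left
      have hm : MeasurableSet (f ⁻¹' U) := comap_shift_le 0 _ (tail_le 0 _ (hfm hU))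
      exact (mem_ae_iff_prob_eq_one hm).2 h
  have hval : ∀ n (u : V n), x n u = c * μ.real {s : ∀ n, V n | s n = u} := by
    intro n u
    set S := {s : ∀ n, V n | s n = u} with hS
    have hSm : MeasurableSet S := meas_coord n u
    have hSF : MeasurableSet[Filtration.piLE (X := V) n] S := by
      refine ⟨{w | w ⟨n, Set.mem_Iic.2 le_rfl⟩ = u}, ?_, rfl⟩
      have hev : Measurable (fun w : (∀ i : Set.Iic n, V i) => w ⟨n, Set.mem_Iic.2 le_rfl⟩) :=
        measurable_pi_apply (X := fun i : Set.Iic n => V i) _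
      exact hev (MeasurableSet.of_discrete (s := {u}))
    have h1 : ∀ m, n ≤ m → ∫ t in S, dens μ x m t ∂μ = x n u := by
      intro m hm
      rw [← hM.setIntegral_eq hm hSF, dens_setInt μ x n u S hSm (fun t ht => ht),
        dens_coord μ x hx0 hxK]
    have h2 : Tendsto (fun m => ∫ t in S, dens μ x m t ∂μ) atTop (𝓝 (∫ t in S, c ∂μ)) := by
      refine tendsto_integral_of_dominated_convergence (fun _ => K)
        (fun m => (dens_meas μ x m).aestronglyMeasurable) (integrable_const _)
        (fun m => Filter.Eventually.of_forall (dens_bound μ x hx0 hK hxK m)) ?_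
      refine ae_restrict_of_ae ?_
      filter_upwards [hf, hc] with t h1 h2
      rw [h2] at h1
      exact h1
    have h3 : Tendsto (fun m => ∫ t in S, dens μ x m t ∂μ) atTop (𝓝 (x n u)) :=
      tendsto_const_nhds.congr' ((eventually_ge_atTop n).mono fun m hm => (h1 m hm).symm)
    have h4 := tendsto_nhds_unique h3 h2
    rw [h4, setIntegral_const, smul_eq_mul, mul_comm]
  have hc1 : c = 1 := by
    have h1 : ∑ u, x 0 u = 1 := (hx.1 0).2
    have h2 := real_split μ Set.univ MeasurableSet.univ 0
    simp only [Set.inter_univ, probReal_univ] at h2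
    rw [Finset.sum_congr rfl fun u _ => hval 0 u, ← Finset.mul_sum, ← h2] at h1
    linarith
  funext n u
  rw [hval n u, hc1, one_mul]; rfl

lemma marg_mem (hpos : ∀ n (v : V (n + 1)) (u : V n), 0 ≤ lam n v u)
    (hsum : ∀ n (v : V (n + 1)), ∑ u, lam n v u = 1)
    (μ : Measure (∀ n, V n)) (hμ : μ ∈ Mlam V lam) : marg V μ ∈ SigmaInf V lam := by
  have := hμ.1
  have h := cond_mem hpos hsum μ hμ Set.univ MeasurableSet.univ (by simp)
  simp only [Set.inter_univ, probReal_univ, div_one] at h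
  exact h

lemma backward (hpos : ∀ n (v : V (n + 1)) (u : V n), 0 ≤ lam n v u)
    (hsum : ∀ n (v : V (n + 1)), ∑ u, lam n v u = 1)
    (μ : Measure (∀ n, V n)) (hμ : μ ∈ Mlam V lam)
    (htriv : ∀ A : Set (∀ n, V n), MeasurableSet[tailSigmaAlgebra V] A → μ A = 0 ∨ μ A = 1) :
    marg V μ ∈ Set.extremePoints ℝ (SigmaInf V lam) := by
  refine ⟨marg_mem hpos hsum μ hμ, ?_⟩
  rintro x hx y hy ⟨a, b, ha, hb, -, hab⟩
  refine backward_aux hpos hsum μ hμ htriv x hx (inv_nonneg.2 ha.le) fun n u => ?_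
  have h : a * x n u + b * y n u = μ.real {s : ∀ n, V n | s n = u} :=
    congrFun (congrFun hab n) u
  have hy0 := mul_nonneg hb.le ((hy.1 n).1 u)
  rw [← h, le_inv_mul_iff₀ ha]
  linarith

end helpers

/-- a measure `μ ∈ M(λ)` corresponds to an extreme point of `Σ∞` exactly when
it is ergodic: its marginal sequence is an extreme point of `Σ∞` iff the tail σ-algebra is
`μ`-trivial. -/
theorem extreme_iff_tail_trivial
    (V : ℕ → Type) [∀ n, Fintype (V n)] [∀ n, Nonempty (V n)]
    [∀ n, MeasurableSpace (V n)] [∀ n, DiscreteMeasurableSpace (V n)]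
    (lam : ∀ n, V (n + 1) → V n → ℝ)
    (hpos : ∀ n (v : V (n + 1)) (u : V n), 0 ≤ lam n v u)
    (hsum : ∀ n (v : V (n + 1)), ∑ u, lam n v u = 1)
    (μ : Measure (∀ n, V n)) (hμ : μ ∈ Mlam V lam) :
    marg V μ ∈ Set.extremePoints ℝ (SigmaInf V lam) ↔
      ∀ A : Set (∀ n, V n), MeasurableSet[tailSigmaAlgebra V] A → μ A = 0 ∨ μ A = 1 := by
  exact ⟨fun h A hA => forward hpos hsum μ hμ h A hA, backward hpos hsum μ hμ⟩
end
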